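/- Chaitin's halting probability Ω is not a period. -/

import Mathlib

/-- A partial machine on binary strings has prefix-free domain. -/
def PrefixFreeDom (M : List Bool →. List Bool) : Prop :=
  ∀ p q : List Bool, (M p).Dom → (M q).Dom → p <+: q → p = q

/-- `M` is a universal prefix-free machine: it simulates every partial
recursive prefix-free machine via a fixed prefix. -/
def UniversalPF (M : List Bool →. List Bool) : Prop :=
  ∀ N : List Bool →. List Bool, Partrec N → PrefixFreeDom N →
    ∃ w : List Bool, ∀ p : List Bool, M (w ++ p) = N p

/-- Chaitin's halting probability of a machine `M`. -/
noncomputable def chaitinOmega (M : List Bool →. List Bool) : ℝ :=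
  ∑' p : {p : List Bool // (M p).Dom}, (2 : ℝ) ^ (-(p.val.length : ℤ))
open MeasureTheory in
/-- `x` is a period: an absolutely convergent integral of a rational function
with rational coefficients over a domain in `ℝⁿ` cut out by finitely many
polynomial inequalities with rational coefficients. -/
def IsPeriod (x : ℝ) : Prop :=
  ∃ (n : ℕ) (f g : MvPolynomial (Fin n) ℚ) (ps : List (MvPolynomial (Fin n) ℚ)),
    IntegrableOn
      (fun v : Fin n → ℝ => (MvPolynomial.aeval v) f / (MvPolynomial.aeval v) g)
      {v : Fin n → ℝ | ∀ P ∈ ps, 0 ≤ (MvPolynomial.aeval v) P} volume ∧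
    x = ∫ v in {v : Fin n → ℝ | ∀ P ∈ ps, 0 ≤ (MvPolynomial.aeval v) P},
      (MvPolynomial.aeval v) f / (MvPolynomial.aeval v) g


section PartP1

/-- Real valued functions given by primitive recursive signed fractions. -/
def RP {α : Type} [Primcodable α] (f : α → ℝ) : Prop :=
  ∃ a b d : α → ℕ, Primrec a ∧ Primrec b ∧ Primrec d ∧ (∀ x, 0 < d x) ∧
    ∀ x, f x = ((a x : ℝ) - b x) / d x

namespace RP
variable {α β : Type} [Primcodable α] [Primcodable β] {f g : α → ℝ}

theorem of_eq (hf : RP f) (h : ∀ x, f x = g x) : RP g := by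
  have : f = g := funext h
  rwa [← this]

theorem natCast {f : α → ℕ} (hf : Primrec f) : RP (fun x => (f x : ℝ)) :=
  ⟨f, fun _ => 0, fun _ => 1, hf, Primrec.const 0, Primrec.const 1, by simp, by simp⟩

theorem invNat {f : α → ℕ} (hf : Primrec f) (h : ∀ x, 0 < f x) : RP (fun x => 1 / (f x : ℝ)) :=
  ⟨fun _ => 1, fun _ => 0, f, Primrec.const 1, Primrec.const 0, hf, h, by simp⟩

theorem comp {f : β → ℝ} (hf : RP f) {g : α → β} (hg : Primrec g) : RP (fun x => f (g x)) := by
  obtain ⟨a, b, d, ha, hb, hd, h0, h⟩ := hf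
  exact ⟨_, _, _, ha.comp hg, hb.comp hg, hd.comp hg, fun x => h0 _, fun x => h _⟩

theorem neg (hf : RP f) : RP (fun x => - f x) := by
  obtain ⟨a, b, d, ha, hb, hd, h0, h⟩ := hf
  exact ⟨b, a, d, hb, ha, hd, h0, fun x => by simp only [h]; ring⟩

theorem add (hf : RP f) (hg : RP g) : RP (fun x => f x + g x) := by
  obtain ⟨a, b, d, ha, hb, hd, h0, h⟩ := hf
  obtain ⟨a', b', d', ha', hb', hd', h0', h'⟩ := hg
  refine ⟨fun x => a x * d' x + a' x * d x, fun x => b x * d' x + b' x * d x,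
    fun x => d x * d' x, ?_, ?_, ?_, fun x => Nat.mul_pos (h0 x) (h0' x), fun x => ?_⟩
  · exact Primrec.nat_add.comp (Primrec.nat_mul.comp ha hd') (Primrec.nat_mul.comp ha' hd)
  · exact Primrec.nat_add.comp (Primrec.nat_mul.comp hb hd') (Primrec.nat_mul.comp hb' hd)
  · exact Primrec.nat_mul.comp hd hd'
  · have h1 : (d x : ℝ) ≠ 0 := by exact_mod_cast (h0 x).ne'
    have h2 : (d' x : ℝ) ≠ 0 := by exact_mod_cast (h0' x).ne'
    simp only [h, h']; push_cast; field_simp; ring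

theorem mul (hf : RP f) (hg : RP g) : RP (fun x => f x * g x) := by
  obtain ⟨a, b, d, ha, hb, hd, h0, h⟩ := hf
  obtain ⟨a', b', d', ha', hb', hd', h0', h'⟩ := hg
  refine ⟨fun x => a x * a' x + b x * b' x, fun x => a x * b' x + b x * a' x,
    fun x => d x * d' x, ?_, ?_, ?_, fun x => Nat.mul_pos (h0 x) (h0' x), fun x => ?_⟩
  · exact Primrec.nat_add.comp (Primrec.nat_mul.comp ha ha') (Primrec.nat_mul.comp hb hb')
  · exact Primrec.nat_add.comp (Primrec.nat_mul.comp ha hb') (Primrec.nat_mul.comp hb ha')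
  · exact Primrec.nat_mul.comp hd hd'
  · have h1 : (d x : ℝ) ≠ 0 := by exact_mod_cast (h0 x).ne'
    have h2 : (d' x : ℝ) ≠ 0 := by exact_mod_cast (h0' x).ne'
    simp only [h, h']; push_cast; field_simp; ring

theorem sub (hf : RP f) (hg : RP g) : RP (fun x => f x - g x) :=
  (hf.add hg.neg).of_eq fun x => by ring

theorem constRat (q : ℚ) : RP (fun _ : α => (q : ℝ)) := by
  refine ⟨fun _ => q.num.toNat, fun _ => (-q.num).toNat, fun _ => q.den, Primrec.const _,
    Primrec.const _, Primrec.const _, fun _ => q.den_pos, fun _ => ?_⟩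
  have : ((q.num.toNat : ℕ) : ℝ) - (((-q.num).toNat : ℕ) : ℝ) = (q.num : ℝ) := by
    have h := Int.toNat_sub_toNat_neg q.num
    exact_mod_cast h
  simp only [this]
  have h := (Rat.num_div_den q).symm
  calc (q : ℝ) = ((q.num / q.den : ℚ) : ℝ) := by rw [← h]
    _ = _ := by push_cast; rfl

theorem ind {p : α → Prop} [DecidablePred p] (hp : PrimrecPred p) :
    RP (fun x => if p x then (1 : ℝ) else 0) := by
  have : Primrec (fun x => if p x then 1 else 0) :=
    Primrec.ite hp (Primrec.const 1) (Primrec.const 0)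
  exact (natCast this).of_eq fun x => by split_ifs <;> simp

theorem pos (hf : RP f) : PrimrecPred (fun x => 0 < f x) := by
  obtain ⟨a, b, d, ha, hb, hd, h0, h⟩ := hf
  refine (Primrec.nat_lt.comp hb ha).of_eq fun x => ?_
  have h1 : (0 : ℝ) < d x := by exact_mod_cast (h0 x)
  rw [h, div_pos_iff_of_pos_right h1, sub_pos, Nat.cast_lt]

theorem sum {f : α × ℕ → ℝ} (hf : RP f) {N : α → ℕ} (hN : Primrec N) :
    RP (fun x => ∑ i ∈ Finset.range (N x), f (x, i)) := by
  obtain ⟨a, b, d, ha, hb, hd, h0, h⟩ := hf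
  let G : α → ℕ → ℕ × ℕ × ℕ := fun x n => Nat.rec (0, 0, 1) (fun i r =>
    (r.1 * d (x, i) + a (x, i) * r.2.2, r.2.1 * d (x, i) + b (x, i) * r.2.2,
      r.2.2 * d (x, i))) n
  have hG : Primrec₂ G := by
    refine Primrec.nat_rec (f := fun _ : α => ((0, 0, 1) : ℕ × ℕ × ℕ))
      (g := fun x (q : ℕ × (ℕ × ℕ × ℕ)) =>
      (q.2.1 * d (x, q.1) + a (x, q.1) * q.2.2.2, q.2.2.1 * d (x, q.1) + b (x, q.1) * q.2.2.2,
      q.2.2.2 * d (x, q.1))) (Primrec.const _) ?_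
    have hi : Primrec (fun z : α × (ℕ × (ℕ × ℕ × ℕ)) => (z.1, z.2.1)) :=
      Primrec.pair Primrec.fst (Primrec.fst.comp Primrec.snd)
    have r := (Primrec.snd (α := ℕ) (β := ℕ × ℕ × ℕ)).comp
      (Primrec.snd (α := α) (β := ℕ × (ℕ × ℕ × ℕ)))
    have r1 := Primrec.fst.comp r
    have r2 := Primrec.fst.comp (Primrec.snd.comp r)
    have r3 := Primrec.snd.comp (Primrec.snd.comp r)
    refine Primrec.pair ?_ (Primrec.pair ?_ ?_)
    · exact Primrec.nat_add.comp (Primrec.nat_mul.comp r1 (hd.comp hi))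
        (Primrec.nat_mul.comp (ha.comp hi) r3)
    · exact Primrec.nat_add.comp (Primrec.nat_mul.comp r2 (hd.comp hi))
        (Primrec.nat_mul.comp (hb.comp hi) r3)
    · exact Primrec.nat_mul.comp r3 (hd.comp hi)
  have hs : Primrec (fun x => G x (N x)) := hG.comp Primrec.id hN
  have key : ∀ x n, 0 < (G x n).2.2 ∧ ∑ i ∈ Finset.range n, f (x, i) =
      (((G x n).1 : ℝ) - (G x n).2.1) / (G x n).2.2 := by
    intro x n
    induction n with
    | zero => simp [G]
    | succ n ih =>
      have e : G x (n+1) = ((G x n).1 * d (x, n) + a (x, n) * (G x n).2.2,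
        (G x n).2.1 * d (x, n) + b (x, n) * (G x n).2.2, (G x n).2.2 * d (x, n)) := rfl
      rw [e, Finset.sum_range_succ, ih.2, h]
      refine ⟨Nat.mul_pos ih.1 (h0 _), ?_⟩
      have h1 : (d (x, n) : ℝ) ≠ 0 := by exact_mod_cast (h0 _).ne'
      have h2 : ((G x n).2.2 : ℝ) ≠ 0 := by exact_mod_cast ih.1.ne'
      push_cast; field_simp; ring
  exact ⟨_, _, _, Primrec.fst.comp hs, Primrec.fst.comp (Primrec.snd.comp hs),
    Primrec.snd.comp (Primrec.snd.comp hs), fun x => (key x _).1, fun x => (key x _).2⟩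

end RP

theorem primrec_nat_pow : Primrec₂ ((· ^ ·) : ℕ → ℕ → ℕ) :=
  Primrec₂.unpaired'.1 Nat.Primrec.pow

end PartP1

section PartP2

theorem rePred_exists {α : Type} [Primcodable α] {P : α × ℕ → Prop} (hP : PrimrecPred P) :
    REPred fun a => ∃ s, P (a, s) := by
  classical
  have h1 : Primrec (fun x : α × ℕ => decide (P x)) := primrecPred_iff_primrec_decide.1 hP
  have h2 : Partrec₂ (fun (a : α) (s : ℕ) => (Part.some (decide (P (a, s))) : Part Bool)) :=
    h1.to_comp
  have h3 : Partrec (fun a => (Nat.rfind fun s => Part.some (decide (P (a, s)))).map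
      (fun _ => ())) := (Partrec.rfind h2).map (Computable.const ()).to₂
  refine h3.of_eq fun a => ?_
  apply Part.ext'
  · show (Nat.rfind fun s => Part.some (decide (P (a, s)))).Dom ↔ ∃ _ : (∃ s, P (a, s)), True
    refine Nat.rfind_dom.trans ?_
    simp
  · intros; rfl

theorem summable_of_prefixFree (M : List Bool →. List Bool) (hpf : PrefixFreeDom M) :
    Summable (fun p : {p : List Bool // (M p).Dom} => (2 : ℝ) ^ (-(p.val.length : ℤ))) := by
  classical
  by_cases h0 : (M []).Dom
  · have : Finite {p : List Bool // (M p).Dom} := by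
      have : Subsingleton {p : List Bool // (M p).Dom} := by
        constructor
        rintro ⟨a, ha⟩ ⟨b, hb⟩
        have h1 := hpf [] a h0 ha (by simp)
        have h2 := hpf [] b h0 hb (by simp)
        subst h1; subst h2; rfl
      infer_instance
    exact Summable.of_finite
  · refine summable_of_sum_le (c := 1) (fun _ => by positivity) fun u => ?_
    have hu : InformationTheory.UniquelyDecodable
        ((u.map (Function.Embedding.subtype _) : Finset (List Bool)) : Set (List Bool)) := by
      intro L1
      have hS : ∀ w, w ∈ ((u.map (Function.Embedding.subtype _) : Finset (List Bool)) :
          Set (List Bool)) → (M w).Dom := by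
        intro w hw
        simp at hw
        exact hw.1
      generalize ((u.map (Function.Embedding.subtype _) : Finset (List Bool)) :
          Set (List Bool)) = S at hS
      induction L1 with
      | nil =>
        intro L2 _ h2 h
        cases L2 with
        | nil => rfl
        | cons b L2 =>
          exfalso
          have hb := hS b (h2 b (by simp))
          simp at h
          rw [h.1] at hb
          exact h0 hb
      | cons a L1 ih =>
        intro L2 h1 h2 h
        have ha := hS a (h1 a (by simp))
        cases L2 with
        | nil =>
          exfalso
          simp at h
          rw [h.1] at ha
          exact h0 ha
        | cons b L2 =>
          have hb := hS b (h2 b (by simp))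
          simp only [List.flatten_cons] at h
          have hab : a = b := by
            rcases List.prefix_or_prefix_of_prefix (List.prefix_append a L1.flatten)
              (h ▸ List.prefix_append b L2.flatten) with h' | h'
            · exact hpf a b ha hb h'
            · exact (hpf b a hb ha h').symm
          subst hab
          rw [ih L2 (fun w hw => h1 w (by simp [hw])) (fun w hw => h2 w (by simp [hw]))
            (by simpa using h)]
    have := InformationTheory.kraft_mcmillan_inequality hu
    simpa using this

theorem re_compl_dom (M : List Bool →. List Bool)
    (hM : Partrec M) (hpf : PrefixFreeDom M) (r : ℕ → ℝ) (hr : RP r) (C : ℕ)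
    (h : ∀ k, |chaitinOmega M - r k| ≤ C / ((k : ℝ) + 1)) : REPred fun p => ¬ (M p).Dom := by
  classical
  obtain ⟨c, hc⟩ := Nat.Partrec.Code.exists_code.1 hM
  have hsum := summable_of_prefixFree M hpf
  have hdom : ∀ p, (M p).Dom ↔ ∃ s, (Nat.Partrec.Code.evaln s c (Encodable.encode p)).isSome := by
    intro p
    have h1 : Nat.Partrec.Code.eval c (Encodable.encode p) = (M p).map Encodable.encode := by
      rw [hc]; simp
    have h2 : (M p).Dom ↔ (Nat.Partrec.Code.eval c (Encodable.encode p)).Dom := by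
      rw [h1]; simp
    rw [h2, Part.dom_iff_mem]
    simp only [Nat.Partrec.Code.evaln_complete, Option.isSome_iff_exists, Option.mem_def]
    rw [exists_comm]
  have hmono : ∀ {s t p}, s ≤ t → (Nat.Partrec.Code.evaln s c (Encodable.encode (p : List Bool))).isSome
      → (Nat.Partrec.Code.evaln t c (Encodable.encode p)).isSome := by
    intro s t p hst hs
    obtain ⟨x, hx⟩ := Option.isSome_iff_exists.1 hs
    exact Option.isSome_iff_exists.2 ⟨x, Nat.Partrec.Code.evaln_mono hst hx⟩
  let good : ℕ × ℕ → Prop := fun q => (Nat.Partrec.Code.evaln q.1 c q.2).isSome = true ∧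
    Encodable.encode (Encodable.decode q.2 : Option (List Bool)) = q.2 + 1
  let len : ℕ → ℕ := fun n => ((Encodable.decode n : Option (List Bool)).map List.length).getD 0
  let term : ℕ × ℕ → ℝ := fun q => (if good q then (1:ℝ) else 0) * (1 / ((2 ^ len q.2 : ℕ) : ℝ))
  let Om : ℕ → ℝ := fun s => ∑ n ∈ Finset.range s, term (s, n)
  have hev : Primrec (fun q : ℕ × ℕ => Nat.Partrec.Code.evaln q.1 c q.2) :=
    Nat.Partrec.Code.primrec_evaln.comp
      (Primrec.pair (Primrec.pair Primrec.fst (Primrec.const c)) Primrec.snd)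
  have hgood : PrimrecPred good := by
    refine PrimrecPred.and ?_ ?_
    · exact Primrec.eq.comp (Primrec.option_isSome.comp hev) (Primrec.const true)
    · exact Primrec.eq.comp (Primrec.encdec.comp Primrec.snd) (Primrec.succ.comp Primrec.snd)
  have hlen : Primrec len := by
    refine Primrec.option_getD.comp (Primrec.option_map (Primrec.decode) ?_) (Primrec.const 0)
    exact (Primrec.list_length.comp Primrec.snd).to₂
  have hterm : RP term := by
    refine RP.mul (RP.ind hgood) (RP.invNat ?_ (fun _ => by positivity))
    exact primrec_nat_pow.comp (Primrec.const 2) (hlen.comp Primrec.snd)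
  have hOm : RP Om := RP.sum hterm Primrec.id
  -- the finite stage
  have hfin : ∀ s, Set.Finite {p : List Bool |
      (Nat.Partrec.Code.evaln s c (Encodable.encode p)).isSome = true} := by
    intro s
    refine Set.Finite.of_finite_image (f := Encodable.encode) ?_ Encodable.encode_injective.injOn
    refine (Set.finite_lt_nat s).subset ?_
    rintro _ ⟨p, hp, rfl⟩
    obtain ⟨x, hx⟩ := Option.isSome_iff_exists.1 hp
    exact Nat.Partrec.Code.evaln_bound hx
  let E : ℕ → Finset (List Bool) := fun s => (hfin s).toFinset
  have hE : ∀ s p, p ∈ E s ↔ (Nat.Partrec.Code.evaln s c (Encodable.encode p)).isSome = true := by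
    intro s p; simp [E]
  have hOmE : ∀ s, Om s = ∑ p ∈ E s, (2 : ℝ) ^ (-(p.length : ℤ)) := by
    intro s
    have h1 : ∑ p ∈ E s, (2 : ℝ) ^ (-(p.length : ℤ)) = ∑ p ∈ E s, term (s, Encodable.encode p) := by
      refine Finset.sum_congr rfl fun p hp => ?_
      have : good (s, Encodable.encode p) := ⟨(hE s p).1 hp, by simp⟩
      simp [term, this, len]
    rw [h1, ← Finset.sum_image (f := fun n => term (s, n)) (g := Encodable.encode)
      Encodable.encode_injective.injOn]
    symm
    refine Finset.sum_subset ?_ ?_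
    · intro n hn
      obtain ⟨p, hp, rfl⟩ := Finset.mem_image.1 hn
      obtain ⟨x, hx⟩ := Option.isSome_iff_exists.1 ((hE s p).1 hp)
      exact Finset.mem_range.2 (Nat.Partrec.Code.evaln_bound hx)
    · intro n _ hn
      have : ¬ good (s, n) := by
        rintro ⟨h1, h2⟩
        simp only at h1 h2
        cases hd : (Encodable.decode n : Option (List Bool)) with
        | none => rw [hd] at h2; simp at h2
        | some p =>
          rw [hd] at h2
          simp only [Encodable.encode_some, Nat.succ_eq_add_one, add_left_inj] at h2
          subst h2
          exact hn (Finset.mem_image_of_mem _ ((hE s p).2 h1))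
      simp [term, this]
  -- comparison of finite sums with Omega
  have hfs : ∀ F : Finset (List Bool), (∀ p ∈ F, (M p).Dom) →
      ∑ p ∈ F, (2 : ℝ) ^ (-(p.length : ℤ)) ≤ chaitinOmega M := by
    intro F hF
    have := hsum.sum_le_tsum (F.subtype (fun p => (M p).Dom)) (fun _ _ => by positivity)
    rw [Finset.sum_subtype_of_mem (fun p : List Bool => (2 : ℝ) ^ (-(p.length : ℤ))) hF] at this
    exact this
  have hlim : ∀ ε > 0, ∃ s0, ∀ s ≥ s0, chaitinOmega M - ε < Om s := by
    intro ε hε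
    obtain ⟨F, hF⟩ := (hsum.hasSum.eventually (lt_mem_nhds (a := chaitinOmega M - ε)
      (by unfold chaitinOmega; linarith))).exists
    have : ∃ s0, ∀ p ∈ F, (Nat.Partrec.Code.evaln s0 c (Encodable.encode p.val)).isSome := by
      choose! s hs using fun p : {p : List Bool // (M p).Dom} => (hdom p.1).1 p.2
      exact ⟨F.sup s, fun p hp => hmono (Finset.le_sup hp) (hs p)⟩
    obtain ⟨s0, hs0⟩ := this
    refine ⟨s0, fun s hs => hF.trans_le ?_⟩
    rw [hOmE]
    have hmap := Finset.sum_map F (Function.Embedding.subtype _)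
      (fun p : List Bool => (2 : ℝ) ^ (-(p.length : ℤ)))
    refine (le_of_eq hmap.symm).trans ?_
    refine Finset.sum_le_sum_of_subset_of_nonneg ?_ (fun _ _ _ => by positivity)
    intro p hp
    obtain ⟨q, hq, rfl⟩ := Finset.mem_map.1 hp
    exact (hE s _).2 (hmono hs (hs0 q hq))
  let P : List Bool × ℕ → Prop := fun q =>
    ¬ ((Nat.Partrec.Code.evaln q.2 c (Encodable.encode q.1)).isSome = true) ∧
    0 < Om q.2 + 1 / ((2 ^ q.1.length : ℕ) : ℝ) - (r q.2 + (C : ℝ) * (1 / ((q.2 + 1 : ℕ) : ℝ)))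
  have hP : PrimrecPred P := by
    refine PrimrecPred.and (PrimrecPred.not ?_) (RP.pos ?_)
    · exact Primrec.eq.comp (Primrec.option_isSome.comp
        (hev.comp (Primrec.pair Primrec.snd (Primrec.encode.comp Primrec.fst)))) (Primrec.const true)
    · refine RP.sub (RP.add (hOm.comp Primrec.snd) (RP.invNat ?_ (fun _ => by positivity)))
        (RP.add (hr.comp Primrec.snd) (RP.mul (RP.natCast (Primrec.const C))
          (RP.invNat (Primrec.succ.comp Primrec.snd) (fun _ => by positivity))))
      exact primrec_nat_pow.comp (Primrec.const 2) (Primrec.list_length.comp Primrec.fst)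
  refine (rePred_exists hP).of_eq fun p => ⟨?_, ?_⟩
  · rintro ⟨s, h1, h2⟩ hp
    simp only at h1 h2
    have h3 := hfs (insert p (E s)) (by
      intro q hq
      rcases Finset.mem_insert.1 hq with rfl | hq
      · exact hp
      · exact (hdom q).2 ⟨s, (hE s q).1 hq⟩)
    rw [Finset.sum_insert (fun hh => h1 ((hE s p).1 hh)), ← hOmE] at h3
    have h4 := (abs_le.1 (h s)).2
    have h5 : (2 : ℝ) ^ (-(p.length : ℤ)) = 1 / ((2 ^ p.length : ℕ) : ℝ) := by simp
    have h6 : (C : ℝ) * (1 / ((s + 1 : ℕ) : ℝ)) = C / ((s : ℝ) + 1) := by push_cast; ring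
    linarith
  · intro hp
    set ε : ℝ := 1 / ((2 ^ p.length : ℕ) : ℝ) with hεd
    have hε : 0 < ε := by positivity
    obtain ⟨s0, hs0⟩ := hlim (ε / 2) (by positivity)
    obtain ⟨k, hk⟩ := exists_nat_gt (4 * C / ε)
    refine ⟨max s0 k, fun hh => hp ((hdom p).2 ⟨_, hh⟩), ?_⟩
    simp only
    set s := max s0 k
    have h1 := hs0 s (le_max_left _ _)
    have h4 := (abs_le.1 (h s)).1
    have h6 : (C : ℝ) * (1 / ((s + 1 : ℕ) : ℝ)) = C / ((s : ℝ) + 1) := by push_cast; ring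
    have h7 : (C : ℝ) / ((s : ℝ) + 1) < ε / 4 := by
      have hks : (k : ℝ) ≤ s := by exact_mod_cast le_max_right s0 k
      have hs1 : (0 : ℝ) < (s : ℝ) + 1 := by positivity
      rw [div_lt_iff₀ hε] at hk
      rw [div_lt_iff₀ hs1]
      nlinarith
    rw [h6]
    linarith

theorem omega_not_approx (M : List Bool →. List Bool)
    (hM : Partrec M) (hpf : PrefixFreeDom M) (huniv : UniversalPF M) (r : ℕ → ℝ) (hr : RP r) (C : ℕ)
    (h : ∀ k, |chaitinOmega M - r k| ≤ C / ((k : ℝ) + 1)) : False := by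
  have hre := re_compl_dom M hM hpf r hr C h
  let str : ℕ → List Bool := fun k => (List.range k).map (fun _ => true) ++ [false]
  have hstr : Primrec str := Primrec.list_append.comp
    (Primrec.list_map Primrec.list_range (Primrec.const true).to₂) (Primrec.const [false])
  have hlen : ∀ k, (str k).length = k + 1 := by intro k; simp [str]
  let N : List Bool →. List Bool := fun p =>
    bif decide (p = str (p.length - 1)) then
      (Nat.Partrec.Code.eval (Denumerable.ofNat Nat.Partrec.Code (p.length - 1)) 0).map (fun _ => [])
    else Part.none
  have hl1 : Primrec (fun p : List Bool => p.length - 1) :=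
    Primrec.nat_sub.comp Primrec.list_length (Primrec.const 1)
  have hN : Partrec N := by
    refine Partrec.cond ?_ ?_ Partrec.none
    · exact (primrecPred_iff_primrec_decide.1 (Primrec.eq.comp Primrec.id (hstr.comp hl1))).to_comp
    · refine Partrec.map ?_ (Computable.const []).to₂
      exact Nat.Partrec.Code.eval_part.comp (((Primrec.ofNat _).comp hl1).to_comp)
        (Computable.const 0)
  have hform : ∀ p, (N p).Dom → ∃ k, p = str k := by
    intro p hp
    by_cases hh : p = str (p.length - 1)
    · exact ⟨_, hh⟩
    · simp [N, hh] at hp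
  have hNpf : PrefixFreeDom N := by
    intro p q hp hq hpq
    obtain ⟨j, rfl⟩ := hform p hp
    obtain ⟨k, rfl⟩ := hform q hq
    by_contra hne
    have hjk : j < k := by
      have := hpq.length_le
      rw [hlen, hlen] at this
      rcases Nat.lt_or_ge j k with h | h
      · exact h
      · exact absurd (by rw [show j = k by omega]) hne
    have h1 := hpq.getElem (i := j) (by rw [hlen]; omega)
    simp [str, hjk] at h1
  obtain ⟨w, hw⟩ := huniv N hN hNpf
  refine ComputablePred.halting_problem_not_re 0 ?_
  have hg : Primrec (fun c : Nat.Partrec.Code => w ++ str (Encodable.encode c)) :=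
    Primrec.list_append.comp (Primrec.const w) (hstr.comp Primrec.encode)
  have h2 : REPred (fun c : Nat.Partrec.Code => ¬ (M (w ++ str (Encodable.encode c))).Dom) :=
    Partrec.comp hre hg.to_comp
  refine h2.of_eq fun c => ?_
  rw [hw]
  have : N (str (Encodable.encode c)) = (Nat.Partrec.Code.eval c 0).map (fun _ => []) := by
    simp [N, hlen]
  rw [this]
  simp

end PartP2

section PartP3

open Polynomial

section RealPoly

theorem poly_mono_or_anti (P : ℝ[X]) {a b : ℝ} (h : ∀ y ∈ Set.Ioo a b, P.derivative.eval y ≠ 0) :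
    StrictMonoOn (fun y => P.eval y) (Set.Icc a b) ∨
    StrictAntiOn (fun y => P.eval y) (Set.Icc a b) := by
  have hc : ContinuousOn (fun y => P.eval y) (Set.Icc a b) := P.continuous.continuousOn
  have hd : ∀ y ∈ Set.Ioo a b, HasDerivWithinAt (fun y => P.eval y) (P.derivative.eval y)
      (Set.Ioo a b) y := fun y _ => (P.hasDerivAt y).hasDerivWithinAt
  rcases hasDerivWithinAt_forall_lt_or_forall_gt_of_forall_ne (convex_Ioo a b) hd h with h1 | h1
  · right
    refine strictAntiOn_of_deriv_neg (convex_Icc a b) hc fun y hy => ?_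
    rw [interior_Icc] at hy
    simpa using h1 y hy
  · left
    refine strictMonoOn_of_deriv_pos (convex_Icc a b) hc fun y hy => ?_
    rw [interior_Icc] at hy
    simpa using h1 y hy

theorem poly_same_sign (P : ℝ[X]) {a b : ℝ} (h : ∀ y ∈ Set.uIcc a b, P.eval y ≠ 0)
    (ha : 0 < P.eval a) : 0 < P.eval b := by
  by_contra hb
  have hivt := intermediate_value_uIcc (f := fun y => P.eval y) (a := a) (b := b)
    P.continuous.continuousOn
  have : (0 : ℝ) ∈ Set.uIcc (P.eval a) (P.eval b) := by
    rw [Set.mem_uIcc]; right; exact ⟨not_lt.1 hb, ha.le⟩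
  obtain ⟨y, hy, h0⟩ := hivt this
  exact h y hy h0

end RealPoly

/-- A Boolean algebra of sets. -/
structure IsBA {X : Type} (B : Set (Set X)) : Prop where
  compl : ∀ s ∈ B, sᶜ ∈ B
  inter : ∀ s ∈ B, ∀ t ∈ B, s ∩ t ∈ B

namespace QE

variable {X : Type}

/-- evaluation at a point -/
def ph (A : Subalgebra ℝ (X → ℝ)) (x : X) : A →+* ℝ :=
  (Pi.evalRingHom (fun _ : X => ℝ) x).comp A.val.toRingHom

/-- specialization of a polynomial -/
noncomputable def pol {A : Subalgebra ℝ (X → ℝ)} (q : A[X]) (x : X) : ℝ[X] := q.map (ph A x)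

theorem ph_apply (A : Subalgebra ℝ (X → ℝ)) (x : X) (a : A) : ph A x a = a.1 x := rfl

theorem pol_eval {A : Subalgebra ℝ (X → ℝ)} (q : A[X]) (x : X) (a : A) :
    (pol q x).eval (a.1 x) = (q.eval a).1 x := by
  unfold pol
  rw [← ph_apply A x a, Polynomial.eval_map, Polynomial.eval₂_hom, ph_apply]

/-- subalgebras whose elements have sign conditions in `B` -/
def Good (B : Set (Set X)) (A : Subalgebra ℝ (X → ℝ)) : Prop :=
  ∀ a ∈ A, {x | 0 < a x} ∈ B

theorem exists_maximal (B : Set (Set X)) (R : Subalgebra ℝ (X → ℝ)) (hR : Good B R) :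
    ∃ A, R ≤ A ∧ Maximal (Good B) A := by
  refine zorn_le_nonempty₀ {A | Good B A} ?_ R hR
  intro c hc hch y hy
  refine ⟨sSup c, ?_, fun z hz => le_sSup hz⟩
  intro a ha
  have hne : c.Nonempty := ⟨y, hy⟩
  have hdir : DirectedOn (· ≤ ·) c := hch.directedOn
  have : a ∈ ((sSup c : Subalgebra ℝ (X → ℝ)) : Set (X → ℝ)) := ha
  have _i : Nonempty c := hne.to_subtype
  rw [sSup_eq_iSup', Subalgebra.coe_iSup_of_directed hdir.directed_val] at this
  obtain ⟨A, haA⟩ := Set.mem_iUnion.1 this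
  exact hc A.2 a haA

variable {B : Set (Set X)} {A : Subalgebra ℝ (X → ℝ)}

theorem mem_of_signs (hA : Maximal (Good B) A) (ξ : X → ℝ) (h : ∀ q : A[X], {x | 0 < (pol q x).eval (ξ x)} ∈ B) :
    ξ ∈ A := by
  let A' : Subalgebra ℝ (X → ℝ) := ((Polynomial.aeval (R := A) ξ).restrictScalars ℝ).range
  have e : ∀ (q : A[X]) (x : X), (Polynomial.aeval ξ q) x = (pol q x).eval (ξ x) := by
    intro q x
    rw [pol, Polynomial.eval_map, Polynomial.aeval_def]
    exact Polynomial.hom_eval₂ q (algebraMap A (X → ℝ)) (Pi.evalRingHom (fun _ : X => ℝ) x) ξ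
  have hA' : Good B A' := by
    rintro _ ⟨q, rfl⟩
    have := h q
    convert this using 3
    rw [← e]; rfl
  have hle : A ≤ A' := by
    intro a ha
    refine ⟨Polynomial.C ⟨a, ha⟩, ?_⟩
    simp [Polynomial.aeval_C]
  have : A' ≤ A := hA.2 hA' hle
  exact this ⟨Polynomial.X, by simp⟩

theorem lt_mem (hA : Maximal (Good B) A) (a b : A) : {x | a.1 x < b.1 x} ∈ B := by
  have := hA.1 (b.1 - a.1) (A.sub_mem b.2 a.2)
  simpa using this

theorem and_mem (hB : IsBA B) {p q : X → Prop} (hp : {x | p x} ∈ B) (hq : {x | q x} ∈ B) :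
    {x | p x ∧ q x} ∈ B := hB.inter _ hp _ hq

theorem not_mem' (hB : IsBA B) {p : X → Prop} (hp : {x | p x} ∈ B) : {x | ¬ p x} ∈ B := hB.compl _ hp

theorem or_mem (hB : IsBA B) {p q : X → Prop} (hp : {x | p x} ∈ B) (hq : {x | q x} ∈ B) :
    {x | p x ∨ q x} ∈ B := by
  have := not_mem' hB (and_mem hB (not_mem' hB hp) (not_mem' hB hq))
  convert this using 2
  ext x
  tauto

theorem false_mem (hB : IsBA B) (hA : Maximal (Good B) A) : {x : X | False} ∈ B := by
  have := hA.1 0 A.zero_mem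
  simpa using this

theorem ex_mem (hB : IsBA B) (hA : Maximal (Good B) A) {ι : Type} (L : Finset ι) {p : ι → X → Prop}
    (hp : ∀ i, {x | p i x} ∈ B) : {x | ∃ i ∈ L, p i x} ∈ B := by
  classical
  induction L using Finset.induction_on with
  | empty => simpa using false_mem hB hA
  | insert a s ha ih =>
    have := or_mem hB (hp a) ih
    simpa using this

theorem all_mem (hB : IsBA B) (hA : Maximal (Good B) A) {ι : Type} (L : Finset ι) {p : ι → X → Prop}
    (hp : ∀ i, {x | p i x} ∈ B) : {x | ∀ i ∈ L, p i x} ∈ B := by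
  have := not_mem' hB (ex_mem hB hA L (fun i => not_mem' hB (hp i)))
  convert this using 2
  ext x; simp

theorem const_mem (hB : IsBA B) (hA : Maximal (Good B) A) (c : Prop) : {x : X | c} ∈ B := by
  by_cases h : c
  · have := not_mem' hB (false_mem hB hA)
    simpa [h] using this
  · simpa [h] using false_mem hB hA

theorem pos_mem (hA : Maximal (Good B) A) (a : A) : {x | 0 < a.1 x} ∈ B := hA.1 a.1 a.2

theorem le_mem (hB : IsBA B) (hA : Maximal (Good B) A) (a b : A) : {x | a.1 x ≤ b.1 x} ∈ B := by
  have := not_mem' hB (lt_mem hA b a)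
  simpa using this

theorem zero_mem (hB : IsBA B) (hA : Maximal (Good B) A) (a : A) : {x | a.1 x = 0} ∈ B := by
  have := and_mem hB (le_mem hB hA a 0) (le_mem hB hA 0 a)
  convert this using 3
  exact le_antisymm_iff

theorem inv_mem (hB : IsBA B) (hA : Maximal (Good B) A) (a : A) : (fun x => (a.1 x)⁻¹) ∈ A := by
  refine mem_of_signs hA _ fun q => ?_
  have h1 := and_mem hB (zero_mem hB hA a) (pos_mem hA (q.eval 0))
  have h2 := and_mem hB (not_mem' hB (zero_mem hB hA a))
    (pos_mem hA (a ^ q.natDegree * (q.reverse.eval a)))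
  convert or_mem hB h1 h2 using 3 with x
  by_cases h0 : a.1 x = 0
  · simp only [h0, inv_zero, true_and, not_true, false_and, or_false]
    rw [← pol_eval]; rfl
  · simp only [h0, false_and, not_false_iff, true_and, false_or]
    have e1 : (a ^ q.natDegree * q.reverse.eval a).1 x =
        (a.1 x) ^ q.natDegree * (q.reverse.eval a).1 x := rfl
    rw [e1, ← pol_eval]
    have h3 : (pol q x).eval ((a.1 x)⁻¹) * (a.1 x) ^ q.natDegree = (pol q.reverse x).eval (a.1 x) := by
      let _ : Invertible ((a.1 x)⁻¹) := ⟨a.1 x, mul_inv_cancel₀ h0, inv_mul_cancel₀ h0⟩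
      have := Polynomial.eval₂_reverse_mul_pow (ph A x) ((a.1 x)⁻¹) q
      unfold pol
      rw [Polynomial.eval_map, Polynomial.eval_map, ← this, mul_assoc, ← mul_pow,
        inv_mul_cancel₀ h0, one_pow, mul_one]
      rfl
    rw [← h3]
    have h4 : a.1 x ^ q.natDegree * (eval (a.1 x)⁻¹ (pol q x) * a.1 x ^ q.natDegree) =
      (a.1 x ^ q.natDegree)^2 * (eval (a.1 x)⁻¹ (pol q x)) := by ring
    rw [h4]
    have h5 : 0 < (a.1 x ^ q.natDegree)^2 := by positivity
    exact (mul_pos_iff_of_pos_left h5).symm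

end QE

end PartP3

section PartP4

open Polynomial

theorem side_lt {P : ℝ[X]} {a b ξ z : ℝ}
    (hm : StrictMonoOn (fun y => P.eval y) (Set.Icc a b) ∨
    StrictAntiOn (fun y => P.eval y) (Set.Icc a b)) (h1 : a < ξ) (h2 : ξ < b)
    (h0 : P.eval ξ = 0) : z < ξ ↔ z ≤ a ∨ (a < z ∧ z < b ∧ 0 < P.eval z * P.eval a) := by
  have ha : a ∈ Set.Icc a b := ⟨le_rfl, (h1.trans h2).le⟩
  have hx : ξ ∈ Set.Icc a b := ⟨h1.le, h2.le⟩
  constructor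
  · intro hz
    rcases le_or_gt z a with h | h
    · exact Or.inl h
    · have hz' : z ∈ Set.Icc a b := ⟨h.le, (hz.trans h2).le⟩
      refine Or.inr ⟨h, hz.trans h2, ?_⟩
      rcases hm with hm | hm
      · have e1 := hm hz' hx hz
        have e2 := hm ha hx h1
        simp only [h0] at e1 e2
        exact mul_pos_of_neg_of_neg e1 e2
      · have e1 := hm hz' hx hz
        have e2 := hm ha hx h1
        simp only [h0] at e1 e2
        exact mul_pos e1 e2
  · rintro (h | ⟨h, h', hp⟩)
    · linarith
    · by_contra hz
      push Not at hz
      have hz' : z ∈ Set.Icc a b := ⟨h.le, h'.le⟩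
      rcases hm with hm | hm
      · have e1 := hm.monotoneOn hx hz' hz
        have e2 := hm ha hx h1
        simp only [h0] at e1 e2
        nlinarith
      · have e1 := hm.antitoneOn hx hz' hz
        have e2 := hm ha hx h1
        simp only [h0] at e1 e2
        nlinarith

theorem side_gt {P : ℝ[X]} {a b ξ z : ℝ}
    (hm : StrictMonoOn (fun y => P.eval y) (Set.Icc a b) ∨
    StrictAntiOn (fun y => P.eval y) (Set.Icc a b)) (h1 : a < ξ) (h2 : ξ < b)
    (h0 : P.eval ξ = 0) : ξ < z ↔ b ≤ z ∨ (a < z ∧ z < b ∧ 0 < P.eval z * P.eval b) := by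
  have hb : b ∈ Set.Icc a b := ⟨(h1.trans h2).le, le_rfl⟩
  have hx : ξ ∈ Set.Icc a b := ⟨h1.le, h2.le⟩
  constructor
  · intro hz
    rcases le_or_gt b z with h | h
    · exact Or.inl h
    · have hz' : z ∈ Set.Icc a b := ⟨(h1.trans hz).le, h.le⟩
      refine Or.inr ⟨h1.trans hz, h, ?_⟩
      rcases hm with hm | hm
      · have e1 := hm hx hz' hz
        have e2 := hm hx hb h2
        simp only [h0] at e1 e2
        exact mul_pos e1 e2
      · have e1 := hm hx hz' hz
        have e2 := hm hx hb h2
        simp only [h0] at e1 e2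
        exact mul_pos_of_neg_of_neg e1 e2
  · rintro (h | ⟨h, h', hp⟩)
    · linarith
    · by_contra hz
      push Not at hz
      have hz' : z ∈ Set.Icc a b := ⟨h.le, h'.le⟩
      rcases hm with hm | hm
      · have e1 := hm.monotoneOn hz' hx hz
        have e2 := hm hx hb h2
        simp only [h0] at e1 e2
        nlinarith
      · have e1 := hm.antitoneOn hz' hx hz
        have e2 := hm hx hb h2
        simp only [h0] at e1 e2
        nlinarith

theorem sign_char {r : ℝ[X]} {ι : Type} {T L : Finset ι} {v : ι → ℝ} {ξ : ℝ}
    (hcov : r ≠ 0 → ∀ y, r.eval y = 0 → ∃ i ∈ L, v i = y) (hLT : L ⊆ T)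
    (hlo : ∃ i ∈ T, v i < ξ) (hhi : ∃ i ∈ T, ξ < v i) :
    0 < r.eval ξ ↔ ∃ i ∈ T, ∃ j ∈ T, v i < ξ ∧ ξ < v j ∧
      (∀ k ∈ L, ¬ (v i < v k ∧ v k < v j ∧ r.eval (v k) = 0)) ∧ 0 < r.eval ((v i + v j)/2) := by
  classical
  have key : ∀ i j, v i < ξ → ξ < v j → r ≠ 0 →
      (∀ k ∈ L, ¬ (v i < v k ∧ v k < v j ∧ r.eval (v k) = 0)) →
      ∀ y, v i < y → y < v j → r.eval y ≠ 0 := by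
    intro i j _ _ hr h y h1 h2 h0
    obtain ⟨k, hk, rfl⟩ := hcov hr y h0
    exact h k hk ⟨h1, h2, h0⟩
  constructor
  · intro hpos
    have hr : r ≠ 0 := by rintro rfl; simp at hpos
    obtain ⟨i0, hi0, hi0'⟩ := hlo
    obtain ⟨j0, hj0, hj0'⟩ := hhi
    obtain ⟨i, hi, himax⟩ := Finset.exists_max_image (T.filter fun i => v i < ξ) v
      ⟨i0, by simp [hi0, hi0']⟩
    obtain ⟨j, hj, hjmin⟩ := Finset.exists_min_image (T.filter fun i => ξ < v i) v
      ⟨j0, by simp [hj0, hj0']⟩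
    simp only [Finset.mem_filter] at hi hj himax hjmin
    have hno : ∀ k ∈ L, ¬ (v i < v k ∧ v k < v j ∧ r.eval (v k) = 0) := by
      rintro k hk ⟨h1, h2, h3⟩
      rcases lt_trichotomy (v k) ξ with h | h | h
      · exact absurd (himax k ⟨hLT hk, h⟩) (by linarith)
      · rw [h] at h3; linarith
      · exact absurd (hjmin k ⟨hLT hk, h⟩) (by linarith)
    refine ⟨i, hi.1, j, hj.1, hi.2, hj.2, hno, ?_⟩
    refine poly_same_sign r (a := ξ) (fun y hy => ?_) hpos
    rw [Set.mem_uIcc] at hy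
    refine key i j hi.2 hj.2 hr hno y ?_ ?_ <;>
    · rcases hy with hy | hy <;> linarith [hi.2, hj.2]
  · rintro ⟨i, hi, j, hj, h1, h2, h3, h4⟩
    have hr : r ≠ 0 := by rintro rfl; simp at h4
    refine poly_same_sign r (a := (v i + v j)/2) (fun y hy => ?_) h4
    rw [Set.mem_uIcc] at hy
    refine key i j h1 h2 hr h3 y ?_ ?_ <;>
    · rcases hy with hy | hy <;> linarith

namespace QE

variable {X : Type} {B : Set (Set X)} {A : Subalgebra ℝ (X → ℝ)}

/-- all roots of specializations of `r` are covered by finitely many elements. -/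
def Cov (r : A[X]) : Prop := ∃ L : Finset A, ∀ x, pol r x ≠ 0 → ∀ y, (pol r x).eval y = 0 →
  ∃ a ∈ L, a.1 x = y

theorem root_mem (hB : IsBA B) (hA : Maximal (Good B) A)
    (p : A[X]) (hp : p.Monic) (hIH : ∀ r : A[X], r.degree < p.degree → Cov r)
    (a b : A) (E : X → Prop) (hE : {x | E x} ∈ B) (ξ : X → ℝ)
    (h0 : ∀ x, ¬ E x → ξ x = 0)
    (h1 : ∀ x, E x → a.1 x < ξ x ∧ ξ x < b.1 x ∧ (pol p x).eval (ξ x) = 0 ∧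
      (StrictMonoOn (fun y => (pol p x).eval y) (Set.Icc (a.1 x) (b.1 x)) ∨
       StrictAntiOn (fun y => (pol p x).eval y) (Set.Icc (a.1 x) (b.1 x)))) : ξ ∈ A := by
  classical
  refine mem_of_signs hA ξ fun q => ?_
  set r := q %ₘ p with hr
  obtain ⟨L, hL⟩ : Cov r := by
    rcases subsingleton_or_nontrivial A with hs | hs
    · have hXe : ∀ x : X, False := by
        intro x
        have : (1 : A) = 0 := Subsingleton.elim _ _
        have h2 : (1 : A).1 x = (0 : A).1 x := by rw [this]
        simp at h2
      exact ⟨∅, fun x => (hXe x).elim⟩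
    · exact hIH r (Polynomial.degree_modByMonic_lt q hp)
  let T : Finset A := insert a (insert b L)
  have hlt : ∀ z : A, {x | z.1 x ≤ a.1 x ∨ (a.1 x < z.1 x ∧ z.1 x < b.1 x ∧
      0 < (pol p x).eval (z.1 x) * (pol p x).eval (a.1 x))} ∈ B := by
    intro z
    refine or_mem hB (le_mem hB hA _ _) (and_mem hB (lt_mem hA _ _) (and_mem hB (lt_mem hA _ _) ?_))
    have := pos_mem hA (p.eval z * p.eval a)
    simpa [pol_eval] using this
  have hgt : ∀ z : A, {x | b.1 x ≤ z.1 x ∨ (a.1 x < z.1 x ∧ z.1 x < b.1 x ∧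
      0 < (pol p x).eval (z.1 x) * (pol p x).eval (b.1 x))} ∈ B := by
    intro z
    refine or_mem hB (le_mem hB hA _ _) (and_mem hB (lt_mem hA _ _) (and_mem hB (lt_mem hA _ _) ?_))
    have := pos_mem hA (p.eval z * p.eval b)
    simpa [pol_eval] using this
  have hmid : ∀ z z' : A, {x | 0 < (pol r x).eval ((z.1 x + z'.1 x) / 2)} ∈ B := by
    intro z z'
    have := pos_mem hA (r.eval ((1/2 : ℝ) • (z + z')))
    convert this using 3 with x
    rw [← pol_eval]
    simp only [Subalgebra.coe_smul, Subalgebra.coe_add, Pi.smul_apply, Pi.add_apply, smul_eq_mul]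
    ring_nf
  have hz : ∀ z : A, {x | (pol r x).eval (z.1 x) = 0} ∈ B := by
    intro z
    simpa [pol_eval] using zero_mem hB hA (r.eval z)
  have S1 := and_mem hB (not_mem' hB hE) (pos_mem hA (q.eval 0))
  have S2 := and_mem hB hE (ex_mem hB hA T (fun z : A => ex_mem hB hA T (fun z' : A =>
    and_mem hB (hlt z) (and_mem hB (hgt z') (and_mem hB
      (all_mem hB hA L (fun k : A => not_mem' hB (and_mem hB (lt_mem hA z k)
        (and_mem hB (lt_mem hA k z') (hz k))))) (hmid z z'))))))
  convert or_mem hB S1 S2 using 3 with x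
  by_cases hx : E x
  · obtain ⟨e1, e2, e3, e4⟩ := h1 x hx
    have hq : (pol q x).eval (ξ x) = (pol r x).eval (ξ x) := by
      have : q = r + p * (q /ₘ p) := (Polynomial.modByMonic_add_div q p).symm
      have h2 : pol q x = pol r x + pol p x * pol (q /ₘ p) x := by
        unfold pol; conv_lhs => rw [this]
        simp
      rw [h2]; simp [e3]
    simp only [hx, not_true, false_and, true_and, false_or]
    rw [hq, sign_char (T := T) (L := L) (v := fun i : A => i.1 x) (hL x)
      (fun k hk => by simp [T, hk]) ⟨a, by simp [T], e1⟩ ⟨b, by simp [T], e2⟩]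
    simp only [side_lt e4 e1 e2 e3, side_gt e4 e1 e2 e3]
  · simp only [hx, not_false_iff, true_and, false_and, or_false, h0 x hx]
    rw [← pol_eval]; rfl

end QE

end PartP4

section PartP5

open Polynomial

namespace QE

variable {X : Type} {B : Set (Set X)} {A : Subalgebra ℝ (X → ℝ)}

theorem root_between {P : ℝ[X]} {a b : ℝ} (hab : a < b) (h : P.eval a * P.eval b < 0) :
    ∃ y, a < y ∧ y < b ∧ P.eval y = 0 := by
  have hivt := intermediate_value_uIcc (f := fun y => P.eval y) (a := a) (b := b)
    P.continuous.continuousOn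
  have : (0 : ℝ) ∈ Set.uIcc (P.eval a) (P.eval b) := by
    rw [Set.mem_uIcc]
    rcases mul_neg_iff.1 h with h | h
    · exact Or.inr ⟨h.2.le, h.1.le⟩
    · exact Or.inl ⟨h.1.le, h.2.le⟩
  obtain ⟨y, hy, h0⟩ := hivt this
  rw [Set.uIcc_of_le hab.le] at hy
  simp only at h0
  refine ⟨y, lt_of_le_of_ne hy.1 ?_, lt_of_le_of_ne hy.2 ?_, h0⟩
  · rintro rfl; simp [h0] at h
  · rintro rfl; simp [h0] at h

theorem exists_bound (p : A[X]) : ∃ M : A, ∀ x, (pol p x).Monic → ∀ y,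
    (pol p x).eval y = 0 → -(M.1 x) < y ∧ y < M.1 x := by
  refine ⟨1 + ∑ i ∈ Finset.range (p.natDegree + 1), (1 + (p.coeff i)^2), fun x hm y hy => ?_⟩
  have h1 := Polynomial.IsRoot.norm_lt_cauchyBound hm.ne_zero (a := y) hy
  have h2 : ((pol p x).cauchyBound : ℝ) ≤
      1 + ∑ i ∈ Finset.range (p.natDegree + 1), (1 + ((p.coeff i).1 x)^2) := by
    rw [Polynomial.cauchyBound, hm.leadingCoeff]
    simp only [nnnorm_one, div_one, NNReal.coe_add, NNReal.coe_one]
    rw [add_comm]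
    gcongr
    have hnn : ∀ i, 0 ≤ (1 + ((p.coeff i).1 x)^2) := fun i => by positivity
    have : (Finset.range (pol p x).natDegree).sup (fun i => ‖(pol p x).coeff i‖₊) ≤
      Real.toNNReal (∑ i ∈ Finset.range (p.natDegree + 1), (1 + ((p.coeff i).1 x)^2)) := by
      refine Finset.sup_le fun i hi => ?_
      refine NNReal.le_toNNReal_of_coe_le ?_
      simp only [coe_nnnorm, Real.norm_eq_abs]
      have e : (pol p x).coeff i = (p.coeff i).1 x := by
        unfold pol; rw [Polynomial.coeff_map]; rfl
      rw [e]
      have hi' : i ∈ Finset.range (p.natDegree + 1) := by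
        have : (pol p x).natDegree ≤ p.natDegree := Polynomial.natDegree_map_le
        simp at hi ⊢; omega
      calc |(p.coeff i).1 x| ≤ 1 + ((p.coeff i).1 x)^2 := by
            rw [abs_le]; constructor <;> nlinarith [sq_nonneg ((p.coeff i).1 x - 1), sq_nonneg ((p.coeff i).1 x + 1)]
        _ ≤ _ := Finset.single_le_sum (f := fun i => 1 + ((p.coeff i).1 x)^2) (fun i _ => hnn i) hi'
    exact (Real.le_toNNReal_iff_coe_le (Finset.sum_nonneg fun i _ => hnn i)).1 this
  have h3 : |y| < 1 + ∑ i ∈ Finset.range (p.natDegree + 1), (1 + ((p.coeff i).1 x)^2) := by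
    refine lt_of_lt_of_le ?_ h2
    exact_mod_cast h1
  have h4 : (1 + ∑ i ∈ Finset.range (p.natDegree + 1), (1 + (p.coeff i)^2) : A).1 x =
    1 + ∑ i ∈ Finset.range (p.natDegree + 1), (1 + ((p.coeff i).1 x)^2) := by
    simp
  rw [h4]
  exact abs_lt.1 h3

theorem monic_cov (hB : IsBA B) (hA : Maximal (Good B) A)
    (p : A[X]) (hp : p.Monic) (hIH : ∀ r : A[X], r.degree < p.degree → Cov r) : Cov p := by
  classical
  rcases subsingleton_or_nontrivial A with hs | hs
  · have hXe : ∀ x : X, False := by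
      intro x
      have : (1 : A) = 0 := Subsingleton.elim _ _
      have h2 : (1 : A).1 x = (0 : A).1 x := by rw [this]
      simp at h2
    exact ⟨∅, fun x => (hXe x).elim⟩
  obtain ⟨L', hL'⟩ := hIH p.derivative (Polynomial.degree_derivative_lt hp.ne_zero)
  obtain ⟨M, hM⟩ := exists_bound p
  let L0 : Finset A := insert M (insert (-M) L')
  let E : A → A → X → Prop := fun a b x => a.1 x < b.1 x ∧
    (∀ l ∈ L0, ¬ (a.1 x < l.1 x ∧ l.1 x < b.1 x)) ∧
    (pol p x).eval (a.1 x) * (pol p x).eval (b.1 x) < 0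
  have hE : ∀ a b, {x | E a b x} ∈ B := by
    intro a b
    refine and_mem hB (lt_mem hA _ _) (and_mem hB (all_mem hB hA L0 (fun l : A => not_mem' hB
      (and_mem hB (lt_mem hA a l) (lt_mem hA l b)))) ?_)
    have := pos_mem hA (-(p.eval a * p.eval b))
    simpa [pol_eval] using this
  have hroot : ∀ a b x, E a b x → ∃ y, a.1 x < y ∧ y < b.1 x ∧ (pol p x).eval y = 0 :=
    fun a b x h => root_between h.1 h.2.2
  let ξ : A → A → X → ℝ := fun a b x => if h : E a b x then (hroot a b x h).choose else 0
  have hmon : ∀ x, (pol p x).Monic := fun x => hp.map _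
  have hder : ∀ x, pol p.derivative x = (pol p x).derivative := fun x => by
    unfold pol; rw [Polynomial.derivative_map]
  have hmono : ∀ (a b : A) x, (∀ l ∈ L0, ¬ (a.1 x < l.1 x ∧ l.1 x < b.1 x)) →
      ∀ y, (pol p x).eval y = 0 → 
      (StrictMonoOn (fun y => (pol p x).eval y) (Set.Icc (a.1 x) (b.1 x)) ∨
       StrictAntiOn (fun y => (pol p x).eval y) (Set.Icc (a.1 x) (b.1 x))) := by
    intro a b x h y hy
    refine poly_mono_or_anti _ fun w hw h0 => ?_
    rw [← hder] at h0
    have hne : pol p.derivative x ≠ 0 := by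
      rw [hder]
      intro h
      have h2 := Polynomial.natDegree_eq_zero_of_derivative_eq_zero h
      have h3 := (hmon x).natDegree_eq_zero.1 h2
      rw [h3] at hy; simp at hy
    obtain ⟨l, hl, rfl⟩ := hL' x hne w h0
    exact h l (by simp [L0, hl]) hw
  have hξ : ∀ a b, ξ a b ∈ A := by
    intro a b
    refine root_mem hB hA p hp hIH a b (E a b) (hE a b) _ ?_ ?_
    · intro x hx; simp [ξ, hx]
    · intro x hx
      obtain ⟨h1, h2, h3⟩ := (hroot a b x hx).choose_spec
      have e : ξ a b x = (hroot a b x hx).choose := by simp [ξ, hx]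
      rw [e]
      exact ⟨h1, h2, h3, hmono a b x hx.2.1 _ h3⟩
  let L1 : Finset A := (L0 ×ˢ L0).image (fun ab => ⟨ξ ab.1 ab.2, hξ _ _⟩)
  refine ⟨L0 ∪ L1, fun x _ y hy => ?_⟩
  by_cases hyL : ∃ l ∈ L0, l.1 x = y
  · obtain ⟨l, hl, h⟩ := hyL
    exact ⟨l, Finset.mem_union_left _ hl, h⟩
  obtain ⟨hM1, hM2⟩ := hM x (hmon x) y hy
  obtain ⟨a, ha, hamax⟩ := Finset.exists_max_image (L0.filter fun i => i.1 x < y) (fun i => i.1 x)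
    ⟨-M, by simp only [L0, Finset.mem_filter]; exact ⟨by simp, hM1⟩⟩
  obtain ⟨b, hb, hbmin⟩ := Finset.exists_min_image (L0.filter fun i => y < i.1 x) (fun i => i.1 x)
    ⟨M, by simp only [L0, Finset.mem_filter]; exact ⟨by simp, hM2⟩⟩
  simp only [Finset.mem_filter] at ha hb hamax hbmin
  have hno : ∀ l ∈ L0, ¬ (a.1 x < l.1 x ∧ l.1 x < b.1 x) := by
    rintro l hl ⟨h1, h2⟩
    rcases lt_trichotomy (l.1 x) y with h | h | h
    · exact absurd (hamax l ⟨hl, h⟩) (by linarith)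
    · exact hyL ⟨l, hl, h⟩
    · exact absurd (hbmin l ⟨hl, h⟩) (by linarith)
  have hmm := hmono a b x hno y hy
  have hab : a.1 x < b.1 x := ha.2.trans hb.2
  have i1 : a.1 x ∈ Set.Icc (a.1 x) (b.1 x) := ⟨le_rfl, hab.le⟩
  have i2 : b.1 x ∈ Set.Icc (a.1 x) (b.1 x) := ⟨hab.le, le_rfl⟩
  have i3 : y ∈ Set.Icc (a.1 x) (b.1 x) := ⟨ha.2.le, hb.2.le⟩
  have hEx : E a b x := by
    refine ⟨hab, hno, ?_⟩
    rcases hmm with h | h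
    · have e1 := h i1 i3 ha.2
      have e2 := h i3 i2 hb.2
      simp only [hy] at e1 e2
      exact mul_neg_of_neg_of_pos e1 e2
    · have e1 := h i1 i3 ha.2
      have e2 := h i3 i2 hb.2
      simp only [hy] at e1 e2
      exact mul_neg_of_pos_of_neg e1 e2
  refine ⟨⟨ξ a b, hξ a b⟩, Finset.mem_union_right _ ?_, ?_⟩
  · simp only [L1, Finset.mem_image]
    exact ⟨(a, b), by simp [ha.1, hb.1], rfl⟩
  · obtain ⟨h1, h2, h3⟩ := (hroot a b x hEx).choose_spec
    have e : ξ a b x = (hroot a b x hEx).choose := by simp [ξ, hEx]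
    show ξ a b x = y
    rw [← e] at h1 h2 h3
    have i4 : ξ a b x ∈ Set.Icc (a.1 x) (b.1 x) := ⟨h1.le, h2.le⟩
    have e5 : (fun y => (pol p x).eval y) (ξ a b x) = (fun y => (pol p x).eval y) y := by
      simp only [h3, hy]
    rcases hmm with h | h
    · exact h.injOn i4 i3 e5
    · exact h.injOn i4 i3 e5

theorem cov_all (hB : IsBA B) (hA : Maximal (Good B) A) (p : A[X]) : Cov p := by
  classical
  induction hn : p.natDegree using Nat.strong_induction_on generalizing p with
  | _ n ih =>
  rcases Nat.eq_zero_or_pos n with h0 | h0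
  · refine ⟨∅, fun x hx y hy => ?_⟩
    rw [h0] at hn
    rw [Polynomial.eq_C_of_natDegree_eq_zero hn] at hx hy
    unfold pol at hx hy
    simp at hx hy
    exact absurd hy hx
  set q := p.eraseLead with hq
  have hqd : q.natDegree < n := by
    have := Polynomial.eraseLead_natDegree_le p
    rw [← hq] at this
    omega
  obtain ⟨L1, hL1⟩ := ih _ hqd q rfl
  let ai : A := ⟨_, inv_mem hB hA p.leadingCoeff⟩
  let p2 : A[X] := Polynomial.X ^ n + C ai * q
  have hd2 : (C ai * q).degree < n := by
    rw [← Polynomial.smul_eq_C_mul]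
    refine lt_of_le_of_lt (Polynomial.degree_smul_le _ _) ?_
    exact lt_of_le_of_lt Polynomial.degree_le_natDegree (by exact_mod_cast hqd)
  have hp2 : p2.Monic := Polynomial.monic_X_pow_add hd2
  obtain ⟨L2, hL2⟩ := monic_cov hB hA p2 hp2 (by
    intro r hr
    by_cases hr0 : r = 0
    · subst hr0
      exact ⟨∅, fun x hx => absurd (by simp [pol]) hx⟩
    have h2 : p2.degree ≤ n := by
      refine (Polynomial.degree_add_le _ _).trans (max_le (Polynomial.degree_X_pow_le _) hd2.le)
    have h3 : r.natDegree < n := by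
      have := hr.trans_le h2
      rw [Polynomial.degree_eq_natDegree hr0] at this
      exact_mod_cast this
    exact ih _ h3 r rfl)
  refine ⟨L1 ∪ L2, fun x hx y hy => ?_⟩
  have e1 : p = q + C p.leadingCoeff * Polynomial.X ^ n := by
    rw [hq, ← hn, Polynomial.eraseLead_add_C_mul_X_pow]
  have e2 : pol p x = pol q x + C (p.leadingCoeff.1 x) * Polynomial.X ^ n := by
    conv_lhs => rw [e1]
    simp [pol, ph_apply]
  by_cases ha : p.leadingCoeff.1 x = 0
  · rw [ha] at e2
    simp at e2
    rw [e2] at hx hy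
    obtain ⟨a, h, h'⟩ := hL1 x hx y hy
    exact ⟨a, Finset.mem_union_left _ h, h'⟩
  · have e3 : pol p2 x = Polynomial.X ^ n + C ((p.leadingCoeff.1 x)⁻¹) * pol q x := by
      simp [pol, p2, ph_apply, ai]
    obtain ⟨a, h, h'⟩ := hL2 x (hp2.map _).ne_zero y (by
      rw [e2] at hy
      rw [e3]
      simp at hy ⊢
      field_simp
      linarith)
    exact ⟨a, Finset.mem_union_right _ h, h'⟩

end QE

end PartP5

section PartP6

open Polynomial

/-- semialgebraic sets over an algebra of functions -/
inductive SAg {X : Type} (R : Subalgebra ℝ (X → ℝ)) : Set X → Prop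
  | pos (f : X → ℝ) (hf : f ∈ R) : SAg R {x | 0 < f x}
  | compl (s : Set X) : SAg R s → SAg R sᶜ
  | inter (s t : Set X) : SAg R s → SAg R t → SAg R (s ∩ t)

theorem SAg.isBA {X : Type} (R : Subalgebra ℝ (X → ℝ)) : IsBA {s | SAg R s} :=
  ⟨fun s hs => SAg.compl s hs, fun s hs t ht => SAg.inter s t hs ht⟩

/-- a space with an algebra of regular functions -/
class PA (X : Type) where
  alg : Subalgebra ℝ (X → ℝ)

instance : PA ℝ := ⟨Algebra.adjoin ℝ {id}⟩

instance (n : ℕ) : PA (Fin n → ℝ) := ⟨Algebra.adjoin ℝ (Set.range fun i => fun v => v i)⟩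

instance {X Y : Type} [PA X] [PA Y] : PA (X × Y) :=
  ⟨Algebra.adjoin ℝ ({f | ∃ g ∈ (PA.alg : Subalgebra ℝ (X → ℝ)), f = fun z => g z.1} ∪
    {f | ∃ g ∈ (PA.alg : Subalgebra ℝ (Y → ℝ)), f = fun z => g z.2})⟩

/-- semialgebraic set -/
def SA {X : Type} [PA X] (s : Set X) : Prop := SAg PA.alg s

/-- regular function -/
def RegF {X : Type} [PA X] (f : X → ℝ) : Prop := f ∈ (PA.alg : Subalgebra ℝ (X → ℝ))

/-- regular map -/
def Reg {X Y : Type} [PA X] [PA Y] (φ : X → Y) : Prop := ∀ f : Y → ℝ, RegF f → RegF fun x => f (φ x)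

namespace QE

variable {X : Type} [PA X]

theorem alg_real_poly {f : ℝ → ℝ} (hf : RegF f) : ∃ p : ℝ[X], ∀ y, f y = p.eval y := by
  refine Algebra.adjoin_induction (p := fun f _ => ∃ p : ℝ[X], ∀ y, f y = p.eval y)
    ?_ ?_ ?_ ?_ hf
  · rintro f rfl
    exact ⟨Polynomial.X, fun y => by simp⟩
  · intro r
    exact ⟨C r, fun y => by simp⟩
  · rintro f g _ _ ⟨p, hp⟩ ⟨q, hq⟩
    exact ⟨p + q, fun y => by simp [hp, hq]⟩
  · rintro f g _ _ ⟨p, hp⟩ ⟨q, hq⟩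
    exact ⟨p * q, fun y => by simp [hp, hq]⟩

theorem rext_poly (A : Subalgebra ℝ (X → ℝ)) (hA : PA.alg ≤ A) {f : X × ℝ → ℝ} (hf : RegF f) :
    ∃ p : A[X], ∀ x y, f (x, y) = (pol p x).eval y := by
  refine Algebra.adjoin_induction (p := fun f _ => ∃ p : A[X], ∀ x y, f (x, y) = (pol p x).eval y)
    ?_ ?_ ?_ ?_ hf
  · rintro f (⟨g, hg, rfl⟩ | ⟨g, hg, rfl⟩)
    · exact ⟨C ⟨g, hA hg⟩, fun x y => by simp [pol, ph_apply]⟩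
    · obtain ⟨p, hp⟩ := alg_real_poly hg
      refine ⟨p.map (algebraMap ℝ A), fun x y => ?_⟩
      have : pol (p.map (algebraMap ℝ A)) x = p := by
        unfold pol
        rw [Polynomial.map_map]
        have : (ph A x).comp (algebraMap ℝ A) = RingHom.id ℝ := by ext r; rfl
        rw [this, Polynomial.map_id]
      rw [this]; exact hp y
  · intro r
    refine ⟨C (algebraMap ℝ A r), fun x y => by simp [pol, ph_apply]⟩
  · rintro f g _ _ ⟨p, hp⟩ ⟨q, hq⟩
    exact ⟨p + q, fun x y => by simp [hp, hq, pol]⟩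
  · rintro f g _ _ ⟨p, hp⟩ ⟨q, hq⟩
    exact ⟨p * q, fun x y => by simp [hp, hq, pol]⟩

variable {B : Set (Set X)} {A : Subalgebra ℝ (X → ℝ)}

theorem fiber_cells (hB : IsBA B) (hA : Maximal (Good B) A) (hR : PA.alg ≤ A) {s : Set (X × ℝ)}
    (hs : SA s) : ∃ L : Finset A, ∀ x y y', (∀ a ∈ L, a.1 x ∉ Set.uIcc y y') →
      ((x, y) ∈ s ↔ (x, y') ∈ s) := by
  classical
  induction hs with
  | pos f hf =>
    obtain ⟨p, hp⟩ := rext_poly A hR hf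
    obtain ⟨L, hL⟩ := cov_all hB hA p
    refine ⟨L, fun x y y' h => ?_⟩
    show 0 < f (x, y) ↔ 0 < f (x, y')
    rw [hp, hp]
    by_cases h0 : pol p x = 0
    · simp [h0]
    · constructor
      · refine poly_same_sign _ (fun w hw h1 => ?_)
        obtain ⟨a, ha, rfl⟩ := hL x h0 w h1
        exact h a ha hw
      · refine poly_same_sign _ (fun w hw h1 => ?_)
        obtain ⟨a, ha, rfl⟩ := hL x h0 w h1
        rw [Set.uIcc_comm] at hw
        exact h a ha hw
  | compl s _ ih =>
    obtain ⟨L, hL⟩ := ih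
    exact ⟨L, fun x y y' h => not_congr (hL x y y' h)⟩
  | inter s t _ _ ih1 ih2 =>
    obtain ⟨L, hL⟩ := ih1
    obtain ⟨L', hL'⟩ := ih2
    exact ⟨L ∪ L', fun x y y' h => and_congr (hL x y y' fun a ha => h a (by simp [ha]))
      (hL' x y y' fun a ha => h a (by simp [ha]))⟩

theorem graph_mem (hB : IsBA B) (hA : Maximal (Good B) A) (hR : PA.alg ≤ A) {s : Set (X × ℝ)}
    (hs : SA s) (a : A) : {x | (x, a.1 x) ∈ s} ∈ B := by
  induction hs with
  | pos f hf =>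
    obtain ⟨p, hp⟩ := rext_poly A hR hf
    have := pos_mem hA (p.eval a)
    simpa [← pol_eval, ← hp] using this
  | compl s _ ih => exact hB.compl _ ih
  | inter s t _ _ ih1 ih2 => exact hB.inter _ ih1 _ ih2

theorem proj_mem (hB : IsBA B) (hA : Maximal (Good B) A) (hR : PA.alg ≤ A) {s : Set (X × ℝ)}
    (hs : SA s) : {x | ∃ y, (x, y) ∈ s} ∈ B := by
  classical
  obtain ⟨L, hL⟩ := fiber_cells hB hA hR hs
  let L' : Finset A := insert 0 (L ∪ (L ×ˢ L).image (fun ab => (1/2 : ℝ) • (ab.1 + ab.2)) ∪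
    L.image (fun a => a + 1) ∪ L.image (fun a => a - 1))
  have := ex_mem hB hA L' (fun a : A => graph_mem hB hA hR hs a)
  convert this using 3 with x
  constructor
  swap
  · rintro ⟨a, _, h⟩; exact ⟨_, h⟩
  rintro ⟨y, hy⟩
  by_cases hyL : ∃ a ∈ L, a.1 x = y
  · obtain ⟨a, ha, rfl⟩ := hyL
    exact ⟨a, by simp [L', ha], hy⟩
  have hne : ∀ a ∈ L, a.1 x ≠ y := fun a ha h => hyL ⟨a, ha, h⟩
  by_cases h1 : (L.filter fun a => a.1 x < y).Nonempty
  · obtain ⟨a, ha, hamax⟩ := Finset.exists_max_image _ (fun i => i.1 x) h1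
    simp only [Finset.mem_filter] at ha hamax
    by_cases h2 : (L.filter fun a => y < a.1 x).Nonempty
    · obtain ⟨b, hb, hbmin⟩ := Finset.exists_min_image _ (fun i => i.1 x) h2
      simp only [Finset.mem_filter] at hb hbmin
      refine ⟨(1/2 : ℝ) • (a + b), ?_, ?_⟩
      · have : (1/2 : ℝ) • (a + b) ∈ (L ×ˢ L).image (fun ab => (1/2 : ℝ) • (ab.1 + ab.2)) :=
          Finset.mem_image.2 ⟨(a, b), by simp [ha.1, hb.1], rfl⟩
        simp only [L', Finset.mem_insert, Finset.mem_union]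
        tauto
      · have e : ((1/2 : ℝ) • (a + b) : A).1 x = (a.1 x + b.1 x)/2 := by
          simp only [Subalgebra.coe_smul, Subalgebra.coe_add, Pi.smul_apply, Pi.add_apply,
            smul_eq_mul]
          ring
        rw [e]
        refine (hL x y _ fun c hc h => ?_).1 hy
        rw [Set.mem_uIcc] at h
        rcases lt_or_gt_of_ne (hne c hc) with hcy | hcy
        · have := hamax c ⟨hc, hcy⟩
          rcases h with h | h <;> linarith [ha.2, hb.2]
        · have := hbmin c ⟨hc, hcy⟩
          rcases h with h | h <;> linarith [ha.2, hb.2]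
    · refine ⟨a + 1, ?_, ?_⟩
      · have : a + 1 ∈ L.image (fun a => a + 1) := Finset.mem_image.2 ⟨a, ha.1, rfl⟩
        simp only [L', Finset.mem_insert, Finset.mem_union]
        tauto
      · have e : (a + 1 : A).1 x = a.1 x + 1 := rfl
        rw [e]
        refine (hL x y _ fun c hc h => ?_).1 hy
        rw [Set.mem_uIcc] at h
        rcases lt_or_gt_of_ne (hne c hc) with hcy | hcy
        · have := hamax c ⟨hc, hcy⟩
          rcases h with h | h <;> linarith [ha.2]
        · exact h2 ⟨c, by simp [hc, hcy]⟩
  · by_cases h2 : (L.filter fun a => y < a.1 x).Nonempty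
    · obtain ⟨b, hb, hbmin⟩ := Finset.exists_min_image _ (fun i => i.1 x) h2
      simp only [Finset.mem_filter] at hb hbmin
      refine ⟨b - 1, ?_, ?_⟩
      · have : b - 1 ∈ L.image (fun a => a - 1) := Finset.mem_image.2 ⟨b, hb.1, rfl⟩
        simp only [L', Finset.mem_insert, Finset.mem_union]
        tauto
      · have e : (b - 1 : A).1 x = b.1 x - 1 := rfl
        rw [e]
        refine (hL x y _ fun c hc h => ?_).1 hy
        rw [Set.mem_uIcc] at h
        rcases lt_or_gt_of_ne (hne c hc) with hcy | hcy
        · exact h1 ⟨c, by simp [hc, hcy]⟩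
        · have := hbmin c ⟨hc, hcy⟩
          rcases h with h | h <;> linarith [hb.2]
    · refine ⟨0, by simp [L'], ?_⟩
      refine (hL x y _ fun c hc h => ?_).1 hy
      rcases lt_or_gt_of_ne (hne c hc) with hcy | hcy
      · exact h1 ⟨c, by simp [hc, hcy]⟩
      · exact h2 ⟨c, by simp [hc, hcy]⟩

theorem exists_max (X : Type) [PA X] : ∃ A, (PA.alg : Subalgebra ℝ (X → ℝ)) ≤ A ∧
    Maximal (Good {s : Set X | SA s}) A :=
  exists_maximal _ _ fun a ha => SAg.pos a ha

end QE

section API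

variable {X Y Z : Type} [PA X] [PA Y] [PA Z]

theorem SA.proj {s : Set (X × ℝ)} (hs : SA s) : SA {x | ∃ y, (x, y) ∈ s} := by
  obtain ⟨A, h1, h2⟩ := QE.exists_max X
  exact QE.proj_mem (SAg.isBA _) h2 h1 hs

theorem SA.fiber_finite {s : Set (X × ℝ)} (hs : SA s) : ∃ D : ℕ, ∀ x, ∃ F : Finset ℝ, F.card ≤ D ∧
    ∀ y y', (∀ a ∈ F, a ∉ Set.uIcc y y') → ((x, y) ∈ s ↔ (x, y') ∈ s) := by
  classical
  obtain ⟨A, h1, h2⟩ := QE.exists_max X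
  obtain ⟨L, hL⟩ := QE.fiber_cells (SAg.isBA _) h2 h1 hs
  refine ⟨L.card, fun x => ⟨L.image fun a => a.1 x, Finset.card_image_le, fun y y' h => ?_⟩⟩
  exact hL x y y' fun a ha => h _ (Finset.mem_image_of_mem _ ha)

theorem SA.not {p : X → Prop} (h : SA {x | p x}) : SA {x | ¬ p x} := SAg.compl _ h
theorem SA.and {p q : X → Prop} (h : SA {x | p x}) (h' : SA {x | q x}) : SA {x | p x ∧ q x} :=
  SAg.inter _ _ h h'
theorem SA.or {p q : X → Prop} (h : SA {x | p x}) (h' : SA {x | q x}) : SA {x | p x ∨ q x} :=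
  QE.or_mem (SAg.isBA _) h h'
theorem SA.imp {p q : X → Prop} (h : SA {x | p x}) (h' : SA {x | q x}) : SA {x | p x → q x} := by
  have := h.not.or h'
  convert this using 3
  tauto
theorem SA.ex {p : X → ℝ → Prop} (h : SA {z : X × ℝ | p z.1 z.2}) : SA {x | ∃ y, p x y} := h.proj
theorem SA.all {p : X → ℝ → Prop} (h : SA {z : X × ℝ | p z.1 z.2}) : SA {x | ∀ y, p x y} := by
  have := (SA.ex (p := fun x y => ¬ p x y) h.not).not
  convert this using 3
  simp

theorem SA.preimage {s : Set Y} (hs : SA s) {φ : X → Y} (hφ : Reg φ) : SA {x | φ x ∈ s} := by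
  induction hs with
  | pos f hf => exact SAg.pos _ (hφ f hf)
  | compl s _ ih => exact SAg.compl _ ih
  | inter s t _ _ ih1 ih2 => exact SAg.inter _ _ ih1 ih2

theorem RegF.add {f g : X → ℝ} (hf : RegF f) (hg : RegF g) : RegF fun x => f x + g x :=
  PA.alg.add_mem hf hg
theorem RegF.sub {f g : X → ℝ} (hf : RegF f) (hg : RegF g) : RegF fun x => f x - g x :=
  PA.alg.sub_mem hf hg
theorem RegF.mul {f g : X → ℝ} (hf : RegF f) (hg : RegF g) : RegF fun x => f x * g x :=
  PA.alg.mul_mem hf hg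
theorem RegF.neg {f : X → ℝ} (hf : RegF f) : RegF fun x => - f x := PA.alg.neg_mem hf
theorem RegF.const (c : ℝ) : RegF fun _ : X => c := PA.alg.algebraMap_mem c

theorem SA.lt {f g : X → ℝ} (hf : RegF f) (hg : RegF g) : SA {x | f x < g x} := by
  have : SA {x | 0 < g x - f x} := SAg.pos _ (hg.sub hf)
  simpa using this
theorem SA.le {f g : X → ℝ} (hf : RegF f) (hg : RegF g) : SA {x | f x ≤ g x} := by
  have := (SA.lt hg hf).not
  simpa using this
theorem SA.eq {f g : X → ℝ} (hf : RegF f) (hg : RegF g) : SA {x | f x = g x} := by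
  have := (SA.le hg hf).and (SA.le hf hg)
  convert this using 3
  rw [le_antisymm_iff, and_comm]

theorem Reg.comp {ψ : Y → Z} {φ : X → Y} (hψ : Reg ψ) (hφ : Reg φ) : Reg fun x => ψ (φ x) :=
  fun f hf => hφ _ (hψ f hf)
theorem Reg.id : Reg fun x : X => x := fun _ h => h
theorem Reg.fst {φ : X → Y × Z} (h : Reg φ) : Reg fun x => (φ x).1 :=
  fun f hf => h (fun z => f z.1) (Algebra.subset_adjoin (Or.inl ⟨f, hf, rfl⟩))
theorem Reg.snd {φ : X → Y × Z} (h : Reg φ) : Reg fun x => (φ x).2 :=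
  fun f hf => h (fun z => f z.2) (Algebra.subset_adjoin (Or.inr ⟨f, hf, rfl⟩))

theorem reg_of_adjoin {S : Set (Y → ℝ)} (hS : (PA.alg : Subalgebra ℝ (Y → ℝ)) = Algebra.adjoin ℝ S)
    {φ : X → Y} (h : ∀ f ∈ S, RegF fun x => f (φ x)) : Reg φ := by
  intro f hf
  unfold RegF at hf
  rw [hS] at hf
  refine Algebra.adjoin_induction (p := fun f _ => RegF fun x => f (φ x)) h ?_ ?_ ?_ hf
  · exact fun r => RegF.const r
  · exact fun f g _ _ hf hg => hf.add hg
  · exact fun f g _ _ hf hg => hf.mul hg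

theorem Reg.mk {φ : X → Y} {ψ : X → Z} (h : Reg φ) (h' : Reg ψ) : Reg fun x => (φ x, ψ x) := by
  refine reg_of_adjoin rfl ?_
  rintro f (⟨g, hg, rfl⟩ | ⟨g, hg, rfl⟩)
  · exact h g hg
  · exact h' g hg

theorem RegF.reg {f : X → ℝ} (h : RegF f) : Reg f := by
  refine reg_of_adjoin rfl ?_
  rintro _ rfl
  exact h

theorem Reg.regF {f : X → ℝ} (h : Reg f) : RegF f :=
  h _root_.id (Algebra.subset_adjoin rfl)

theorem Reg.pi {n : ℕ} {φ : X → Fin n → ℝ} (h : ∀ i, RegF fun x => φ x i) : Reg φ := by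
  refine reg_of_adjoin rfl ?_
  rintro _ ⟨i, rfl⟩
  exact h i

theorem Reg.coord {n : ℕ} {φ : X → Fin n → ℝ} (h : Reg φ) (i : Fin n) : RegF fun x => φ x i :=
  h _ (Algebra.subset_adjoin ⟨i, rfl⟩)

end API

end PartP6

section PartP7

open Polynomial

theorem poly_lower (q : ℝ[X]) (hq : q ≠ 0) : ∃ (c : ℝ) (k : ℕ) (s0 : ℝ), 0 < c ∧ 0 < s0 ∧
    ∀ s, 0 < s → s < s0 → c * s ^ k ≤ |q.eval s| := by
  obtain ⟨g, hg, hnd⟩ := Polynomial.exists_eq_pow_rootMultiplicity_mul_and_not_dvd q hq 0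
  set k := q.rootMultiplicity 0
  have hg0 : g.eval 0 ≠ 0 := by
    intro h
    exact hnd (Polynomial.dvd_iff_isRoot.2 h)
  have hc : Filter.Tendsto (fun s => |g.eval s|) (nhds 0) (nhds |g.eval 0|) :=
    (g.continuous.abs).tendsto 0
  have hpos : |g.eval 0| / 2 < |g.eval 0| := half_lt_self (abs_pos.2 hg0)
  obtain ⟨s0, hs0, h⟩ := Metric.eventually_nhds_iff.1 (hc.eventually (lt_mem_nhds hpos))
  refine ⟨|g.eval 0| / 2, k, s0, by positivity, hs0, fun s h1 h2 => ?_⟩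
  have h3 := h (y := s) (by simpa [abs_of_pos h1] using h2)
  rw [hg]
  simp only [C_0, sub_zero, eval_mul, eval_pow, eval_X, abs_mul, abs_pow, abs_of_pos h1]
  rw [mul_comm]
  gcongr

theorem asym_pos (f : ℝ × ℝ → ℝ) (hf : RegF f) : ∃ (C : ℝ) (m : ℕ) (s0 : ℝ), 0 ≤ C ∧ 0 < s0 ∧
    ∀ s, 0 < s → s < s0 → ∀ t t', C / s ^ m < t → C / s ^ m < t' →
      0 < f (s, t) → 0 < f (s, t') := by
  obtain ⟨p, hp⟩ := QE.rext_poly PA.alg le_rfl hf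
  by_cases hp0 : p = 0
  · refine ⟨0, 0, 1, le_rfl, one_pos, fun s _ _ t t' _ _ h => ?_⟩
    rw [hp, hp0] at h
    simp [QE.pol] at h
  obtain ⟨q, hq⟩ := QE.alg_real_poly (f := p.leadingCoeff.1) p.leadingCoeff.2
  have hq0 : q ≠ 0 := by
    rintro rfl
    apply hp0
    rw [← Polynomial.leadingCoeff_eq_zero]
    ext y
    simpa using hq y
  obtain ⟨c, k, s0, hc, hs0, hlow⟩ := poly_lower q hq0
  have hbd : ∀ j, ∃ K : ℝ, ∀ s ∈ Set.Icc (0:ℝ) 1, |(p.coeff j).1 s| ≤ K := by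
    intro j
    obtain ⟨r, hr⟩ := QE.alg_real_poly (f := (p.coeff j).1) (p.coeff j).2
    obtain ⟨K, hK⟩ := isCompact_Icc.exists_bound_of_continuousOn (s := Set.Icc (0:ℝ) 1)
      r.continuous.continuousOn
    exact ⟨K, fun s hs => by rw [hr]; exact hK s hs⟩
  choose K hK using hbd
  have hK0 : ∀ j, 0 ≤ K j := fun j => (abs_nonneg _).trans (hK j 0 (by simp))
  set KK := ∑ j ∈ Finset.range (p.natDegree + 1), K j
  have hKK : 0 ≤ KK := Finset.sum_nonneg fun j _ => hK0 j
  refine ⟨KK / c + 1, k, min s0 1, by positivity, by positivity, ?_⟩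
  intro s hs1 hs2 t t' ht ht'
  have hs3 := lt_of_lt_of_le hs2 (min_le_left _ _)
  have hs4 := lt_of_lt_of_le hs2 (min_le_right _ _)
  have hl := hlow s hs1 hs3
  have hlpos : 0 < c * s ^ k := by positivity
  rw [hp, hp]
  have hlead : (QE.pol p s).coeff p.natDegree = q.eval s := by
    unfold QE.pol; rw [Polynomial.coeff_map, QE.ph_apply, ← hq]; rfl
  have hne : QE.pol p s ≠ 0 := by
    intro h
    rw [h] at hlead
    simp at hlead
    rw [← hlead] at hl
    simp at hl
    linarith
  have hnd : (QE.pol p s).natDegree = p.natDegree := by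
    refine le_antisymm Polynomial.natDegree_map_le ?_
    refine Polynomial.le_natDegree_of_ne_zero ?_
    rw [hlead]
    intro h; rw [h] at hl; simp at hl; linarith
  have hroot : ∀ y, (QE.pol p s).eval y = 0 → y ≤ (KK / c + 1) / s ^ k := by
    intro y hy
    have h1 := Polynomial.IsRoot.norm_lt_cauchyBound hne (a := y) hy
    have h2 : ((QE.pol p s).cauchyBound : ℝ) ≤ KK / (c * s ^ k) + 1 := by
      rw [Polynomial.cauchyBound]
      simp only [NNReal.coe_add, NNReal.coe_one, NNReal.coe_div, coe_nnnorm]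
      have e1 : (QE.pol p s).leadingCoeff = q.eval s := by
        rw [Polynomial.leadingCoeff, hnd, hlead]
      rw [e1, Real.norm_eq_abs]
      gcongr
      have : (Finset.range (QE.pol p s).natDegree).sup (fun i => ‖(QE.pol p s).coeff i‖₊) ≤
          Real.toNNReal KK := by
        refine Finset.sup_le fun i hi => ?_
        refine NNReal.le_toNNReal_of_coe_le ?_
        simp only [coe_nnnorm, Real.norm_eq_abs]
        have e : (QE.pol p s).coeff i = (p.coeff i).1 s := by
          unfold QE.pol; rw [Polynomial.coeff_map]; rfl
        rw [e]
        have hi' : i ∈ Finset.range (p.natDegree + 1) := by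
          rw [hnd] at hi
          simp at hi ⊢; omega
        calc |(p.coeff i).1 s| ≤ K i := hK i s ⟨hs1.le, hs4.le⟩
          _ ≤ _ := Finset.single_le_sum (f := K) (fun i _ => hK0 i) hi'
      exact (Real.le_toNNReal_iff_coe_le hKK).1 this
    have h3 : |y| < KK / (c * s ^ k) + 1 := lt_of_lt_of_le (by exact_mod_cast h1) h2
    have h4 : KK / (c * s ^ k) + 1 ≤ (KK / c + 1) / s ^ k := by
      rw [add_div, div_div]
      gcongr
      rw [le_div_iff₀ (by positivity), one_mul]
      exact pow_le_one₀ hs1.le hs4.le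
    linarith [le_abs_self y]
  refine poly_same_sign _ fun y hy h0 => ?_
  have := hroot y h0
  rw [Set.mem_uIcc] at hy
  rcases hy with hy | hy <;> linarith

theorem asym (H : Set (ℝ × ℝ)) (hH : SA H) : ∃ (C : ℝ) (m : ℕ) (s0 : ℝ), 0 ≤ C ∧ 0 < s0 ∧
    ∀ s, 0 < s → s < s0 → ∀ t t', C / s ^ m < t → C / s ^ m < t' →
      ((s, t) ∈ H ↔ (s, t') ∈ H) := by
  induction hH with
  | pos f hf =>
    obtain ⟨C, m, s0, h1, h2, h3⟩ := asym_pos f hf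
    exact ⟨C, m, s0, h1, h2, fun s a b t t' ht ht' =>
      ⟨h3 s a b t t' ht ht', h3 s a b t' t ht' ht⟩⟩
  | compl s _ ih =>
    obtain ⟨C, m, s0, h1, h2, h3⟩ := ih
    exact ⟨C, m, s0, h1, h2, fun s a b t t' ht ht' => not_congr (h3 s a b t t' ht ht')⟩
  | inter s t _ _ ih1 ih2 =>
    obtain ⟨C, m, s0, h1, h2, h3⟩ := ih1
    obtain ⟨C', m', s0', h1', h2', h3'⟩ := ih2
    refine ⟨max C C', max m m', min (min s0 s0') 1, le_max_of_le_left h1, by positivity, ?_⟩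
    intro s a b t t' ht ht'
    have b1 : s < s0 := b.trans_le ((min_le_left _ _).trans (min_le_left _ _))
    have b2 : s < s0' := b.trans_le ((min_le_left _ _).trans (min_le_right _ _))
    have b3 : s ≤ 1 := (b.trans_le (min_le_right _ _)).le
    have k1 : C / s ^ m ≤ max C C' / s ^ (max m m') := by
      have : s ^ (max m m') ≤ s ^ m := pow_le_pow_of_le_one a.le b3 (le_max_left _ _)
      have : 0 < s ^ (max m m') := by positivity
      gcongr
      exact le_max_left _ _
    have k2 : C' / s ^ m' ≤ max C C' / s ^ (max m m') := by
      have : s ^ (max m m') ≤ s ^ m' := pow_le_pow_of_le_one a.le b3 (le_max_right _ _)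
      have : 0 < s ^ (max m m') := by positivity
      gcongr
      exact le_max_right _ _
    exact and_congr (h3 s a b1 t t' (by linarith) (by linarith))
      (h3' s a b2 t t' (by linarith) (by linarith))

theorem asym_decay (G : Set (ℝ × ℝ)) (hG : SA G)
    (hev : ∀ s, 0 < s → ∃ T : ℝ, ∀ t, T < t → (t, s) ∉ G) :
    ∃ (C : ℝ) (m : ℕ) (s0 : ℝ), 0 ≤ C ∧ 0 < s0 ∧
    ∀ s t, 0 < s → s < s0 → 0 < t → (t, s) ∈ G → s ^ m ≤ C / t := by
  have hH : SA {z : ℝ × ℝ | (z.2, z.1) ∈ G} := hG.preimage (Reg.mk Reg.id.snd Reg.id.fst)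
  obtain ⟨C, m, s0, h1, h2, h3⟩ := asym _ hH
  refine ⟨C, m, s0, h1, h2, fun s t hs hs0 ht hst => ?_⟩
  have hle : t ≤ C / s ^ m := by
    by_contra hlt
    push Not at hlt
    obtain ⟨T, hT⟩ := hev s hs
    refine hT (max T (C / s ^ m) + 1) (by linarith [le_max_left T (C / s ^ m)]) ?_
    exact (h3 s hs hs0 t _ hlt (by linarith [le_max_right T (C / s ^ m)])).1 hst
  rw [le_div_iff₀ (by positivity)] at hle
  rw [le_div_iff₀ ht]
  linarith

end PartP7

section PartP8

open MeasureTheory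

theorem Reg.const {X Y : Type} [PA X] [PA Y] (c : Y) : Reg fun _ : X => c := fun _ _ => RegF.const _

theorem RegF.measurable {n : ℕ} {f : (Fin n → ℝ) → ℝ} (hf : RegF f) : Measurable f := by
  refine Algebra.adjoin_induction (p := fun f _ => Measurable f) ?_ ?_ ?_ ?_ hf
  · rintro _ ⟨i, rfl⟩
    exact measurable_pi_apply i
  · exact fun r => measurable_const
  · exact fun f g _ _ hf hg => hf.add hg
  · exact fun f g _ _ hf hg => hf.mul hg

theorem SA.measurableSet {n : ℕ} {s : Set (Fin n → ℝ)} (hs : SA s) : MeasurableSet s := by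
  induction hs with
  | pos f hf => exact measurableSet_lt measurable_const (RegF.measurable hf)
  | compl s _ ih => exact ih.compl
  | inter s t _ _ ih1 ih2 => exact ih1.inter ih2

theorem vol_fubini {n : ℕ} {S : Set (Fin (n+1) → ℝ)} (hS : MeasurableSet S) :
    volume S = ∫⁻ x : Fin n → ℝ, volume {y : ℝ | (Fin.cons y x : Fin (n+1) → ℝ) ∈ S} := by
  have h := (volume_preserving_piFinSuccAbove (fun _ : Fin (n+1) => ℝ) 0).symm
  rw [← h.measure_preimage hS.nullMeasurableSet]
  rw [Measure.volume_eq_prod, Measure.prod_apply_symm (h.measurable hS)]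
  refine lintegral_congr fun x => ?_
  congr 1
  ext y
  show (Fin.insertNth 0 y x : Fin (n+1) → ℝ) ∈ S ↔ (Fin.cons y x : Fin (n+1) → ℝ) ∈ S
  rw [Fin.insertNth_zero']

theorem vol_le_of_no_interval {S : Set ℝ} {F : Finset ℝ} {D : ℕ} (hF : F.card ≤ D)
    (hS : ∀ y y', (∀ a ∈ F, a ∉ Set.uIcc y y') → (y ∈ S ↔ y' ∈ S)) {l : ℝ} (hl : 0 < l)
    (hno : ¬ ∃ y, ∀ y', y ≤ y' → y' ≤ y + l → y' ∈ S) : volume S ≤ ENNReal.ofReal (D * l) := by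
  have hsub : S ⊆ ⋃ f ∈ F, Set.Icc (f - l) f := by
    intro y hy
    push Not at hno
    obtain ⟨y', h1, h2, h3⟩ := hno y
    have : ∃ a ∈ F, a ∈ Set.uIcc y y' := by
      by_contra h
      push Not at h
      exact h3 ((hS y y' h).1 hy)
    obtain ⟨a, ha, hay⟩ := this
    rw [Set.uIcc_of_le h1] at hay
    simp only [Set.mem_iUnion]
    exact ⟨a, ha, by linarith [hay.2], hay.1⟩
  calc volume S ≤ volume (⋃ f ∈ F, Set.Icc (f - l) f) := measure_mono hsub
    _ ≤ ∑ f ∈ F, volume (Set.Icc (f - l) f) := measure_biUnion_finset_le _ _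
    _ = F.card * ENNReal.ofReal l := by simp
    _ ≤ D * ENNReal.ofReal l := by gcongr
    _ = _ := by rw [ENNReal.ofReal_mul (by positivity), ENNReal.ofReal_natCast]

theorem vol_box (n : ℕ) (r : ℝ) : volume {v : Fin n → ℝ | ∀ i, |v i| ≤ r} =
    ENNReal.ofReal (2 * r) ^ n := by
  have : {v : Fin n → ℝ | ∀ i, |v i| ≤ r} = Set.pi Set.univ fun _ => Set.Icc (-r) r := by
    ext v
    show (∀ i, |v i| ≤ r) ↔ ∀ i, i ∈ Set.univ → v i ∈ Set.Icc (-r) r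
    simp only [abs_le, Set.mem_univ, Set.mem_Icc, true_imp_iff]
  rw [this, volume_pi_pi]
  simp [← two_mul]

/-- main volume comparison -/
theorem volV (n : ℕ) : ∀ (X : Type) [PA X] (A : Set (X × (Fin n → ℝ))), SA A →
    ∃ (G : Set (X × ℝ)) (D : ℕ), SA G ∧ ∀ u,
      (∀ s, (u, s) ∈ G → 0 < s ∧ ENNReal.ofReal s ≤ volume {v | (u, v) ∈ A}) ∧
      ∀ (K L : ℕ) (c : ℝ), 0 ≤ c → (∀ v, (u, v) ∈ A → ∀ i, |v i| ≤ 2 ^ K) →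
        (∀ s, (u, s) ∈ G → s ≤ c) →
        volume {v | (u, v) ∈ A} ≤
          ENNReal.ofReal (D * (K + L + 2 : ℝ) ^ n * c + D * 2 ^ (K * n) * (1/2) ^ L) := by
  induction n with
  | zero =>
    intro X _ A hA
    refine ⟨{z | (z.1, (default : Fin 0 → ℝ)) ∈ A ∧ z.2 = 1}, 1, ?_, ?_⟩
    · exact (hA.preimage (Reg.mk Reg.id.fst (Reg.const _))).and
        (SA.eq Reg.id.snd.regF (RegF.const 1))
    intro u
    have huniv : (u, (default : Fin 0 → ℝ)) ∈ A → {v : Fin 0 → ℝ | (u, v) ∈ A} = Set.univ := by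
      intro h; ext v; simp only [Set.mem_univ, iff_true]
      show (u, v) ∈ A
      rwa [Subsingleton.elim v default]
    have hvol : volume (Set.univ : Set (Fin 0 → ℝ)) = 1 := by
      simp [volume_pi]
    constructor
    · rintro s ⟨h1, h2⟩
      simp only at h1 h2
      rw [huniv h1, hvol, h2]
      simp
    · intro K L c hc _ hs
      by_cases h : (u, (default : Fin 0 → ℝ)) ∈ A
      · have := hs 1 ⟨h, rfl⟩
        rw [huniv h, hvol]
        rw [← ENNReal.ofReal_one]
        refine ENNReal.ofReal_le_ofReal ?_
        simp
        have : (0:ℝ) < (2^L)⁻¹ := by positivity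
        linarith
      · have : {v : Fin 0 → ℝ | (u, v) ∈ A} = ∅ := by
          ext v
          simp only [Set.mem_empty_iff_false, iff_false]
          rintro hv
          apply h
          have hv' : (u, v) ∈ A := hv
          rwa [Subsingleton.elim v default] at hv'
        rw [this]; simp
  | succ n ih =>
    intro X _ A hA
    let A' : Set ((X × (Fin n → ℝ)) × ℝ) := {z | (z.1.1, (Fin.cons z.2 z.1.2 : Fin (n+1) → ℝ)) ∈ A}
    have hA' : SA A' := by
      refine hA.preimage (Reg.mk Reg.id.fst.fst (Reg.pi fun i => ?_))
      refine Fin.cases ?_ (fun j => ?_) i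
      · simpa using Reg.id.snd.regF
      · simpa using Reg.id.fst.snd.coord j
    obtain ⟨D0, hD0⟩ := hA'.fiber_finite
    let Bset : Set ((X × ℝ) × (Fin n → ℝ)) := {z | 0 < z.1.2 ∧
      ∃ y, ∀ y', y ≤ y' → y' ≤ y + z.1.2 → ((z.1.1, z.2), y') ∈ A'}
    have hBset : SA Bset := by
      refine (SA.lt (RegF.const 0) Reg.id.fst.snd.regF).and ?_
      refine SA.ex (SA.all (SA.imp ?_ (SA.imp ?_ ?_)))
      · exact SA.le Reg.id.fst.snd.regF Reg.id.snd.regF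
      · exact SA.le Reg.id.snd.regF (Reg.id.fst.snd.regF.add Reg.id.fst.fst.fst.snd.regF)
      · exact hA'.preimage (Reg.mk (Reg.mk Reg.id.fst.fst.fst.fst Reg.id.fst.fst.snd) Reg.id.snd)
    obtain ⟨G', D', hG', hGD⟩ := ih (X × ℝ) Bset hBset
    refine ⟨{z | ∃ l, ∃ s', 0 < l ∧ ((z.1, l), s') ∈ G' ∧ z.2 = l * s'},
      2 * D0 * D' + D0 * 2 ^ n + 8 * D0 * D', ?_, fun u => ⟨?_, ?_⟩⟩
    · refine SA.ex (SA.ex ((SA.lt (RegF.const 0) Reg.id.fst.snd.regF).and (SA.and ?_ ?_)))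
      · exact hG'.preimage (Reg.mk (Reg.mk Reg.id.fst.fst.fst Reg.id.fst.snd) Reg.id.snd)
      · exact SA.eq Reg.id.fst.fst.snd.regF (Reg.id.fst.snd.regF.mul Reg.id.snd.regF)
    all_goals
      have hmA : MeasurableSet {v | (u, v) ∈ A} :=
        (hA.preimage (Reg.mk (Reg.const u) Reg.id)).measurableSet
      have hmB : ∀ l, MeasurableSet {x | ((u, l), x) ∈ Bset} := fun l =>
        (hBset.preimage (Reg.mk (Reg.const (u, l)) Reg.id)).measurableSet
      have hvol : volume {v | (u, v) ∈ A} = ∫⁻ x : Fin n → ℝ, volume {y : ℝ | ((u, x), y) ∈ A'} :=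
        vol_fubini hmA
    · rintro _ ⟨l, s', hl, hs', rfl⟩
      obtain ⟨h1, h2⟩ := (hGD (u, l)).1 s' hs'
      refine ⟨mul_pos hl h1, ?_⟩
      rw [hvol, ENNReal.ofReal_mul hl.le]
      calc ENNReal.ofReal l * ENNReal.ofReal s' ≤ ENNReal.ofReal l * volume {x | ((u, l), x) ∈ Bset} := by
            gcongr
        _ = ∫⁻ x, {x | ((u, l), x) ∈ Bset}.indicator (fun _ => ENNReal.ofReal l) x := by
            rw [lintegral_indicator_const (hmB l)]
        _ ≤ _ := by
            refine lintegral_mono fun x => ?_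
            by_cases hx : x ∈ {x | ((u, l), x) ∈ Bset}
            swap
            · rw [Set.indicator_of_notMem hx]; exact bot_le
            rw [Set.indicator_of_mem hx]
            obtain ⟨_, y, hy⟩ := hx
            calc ENNReal.ofReal l = volume (Set.Icc y (y + l)) := by simp
              _ ≤ _ := measure_mono fun y' hy' => hy y' hy'.1 hy'.2
    · intro K L c hc hbox hs
      have hfib : ∀ x y, ((u, x), y) ∈ A' → |y| ≤ 2 ^ K ∧ ∀ i, |x i| ≤ 2 ^ K := by
        intro x y h
        have := hbox _ h
        exact ⟨by simpa using this 0, fun i => by simpa using this i.succ⟩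
      have hnb : ∀ x l, 0 < l → ((u, l), x) ∉ Bset →
          volume {y : ℝ | ((u, x), y) ∈ A'} ≤ ENNReal.ofReal (D0 * l) := by
        intro x l hl h
        obtain ⟨F, hF, hF'⟩ := hD0 (u, x)
        exact vol_le_of_no_interval hF hF' hl fun h' => h ⟨hl, h'⟩
      let ell : ℕ → ℝ := fun k => 2 ^ k * (1/2) ^ L
      have hell : ∀ k, 0 < ell k := fun k => by positivity
      have htop : ∀ x, ((u, ell (K + L + 2)), x) ∉ Bset := by
        rintro x ⟨hl, y, hy⟩
        have h1 := (hfib x _ (hy y le_rfl (by linarith))).1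
        have h2 := (hfib x _ (hy (y + ell (K+L+2)) (by linarith) le_rfl)).1
        have h3 : ell (K + L + 2) = 4 * 2 ^ K := by
          simp only [ell]
          rw [pow_add, pow_add, one_div, inv_pow]
          field_simp
          norm_num
        rw [abs_le] at h1 h2
        have : (0:ℝ) < 2 ^ K := by positivity
        linarith [h1.1, h2.2]
      have hpt : ∀ x, volume {y : ℝ | ((u, x), y) ∈ A'} ≤
          {v : Fin n → ℝ | ∀ i, |v i| ≤ 2 ^ K}.indicator
            (fun _ => ENNReal.ofReal (D0 * (1/2)^L)) x +
          ∑ k ∈ Finset.range (K + L + 2), {x | ((u, ell k), x) ∈ Bset}.indicator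
            (fun _ => ENNReal.ofReal (2 * D0 * ell k)) x := by
        intro x
        by_cases hx : ∀ i, |x i| ≤ 2 ^ K
        swap
        · have : {y : ℝ | ((u, x), y) ∈ A'} = ∅ := by
            ext y
            simp only [Set.mem_empty_iff_false, iff_false]
            exact fun h => hx (hfib x y h).2
          rw [this]; simp
        by_cases h0 : ((u, ell 0), x) ∈ Bset
        swap
        · refine le_add_right ?_
          rw [Set.indicator_of_mem (show x ∈ {v : Fin n → ℝ | ∀ i, |v i| ≤ 2 ^ K} from hx)]
          have := hnb x _ (hell 0) h0
          simpa [ell] using this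
        · refine le_add_left ?_
          have : ∃ k < K + L + 2, ((u, ell k), x) ∈ Bset ∧ ((u, ell (k+1)), x) ∉ Bset := by
            by_contra hcon
            push Not at hcon
            have : ∀ k ≤ K + L + 2, ((u, ell k), x) ∈ Bset := by
              intro k
              induction k with
              | zero => exact fun _ => h0
              | succ k ihk => exact fun h => hcon k (by omega) (ihk (by omega))
            exact htop x (this _ le_rfl)
          obtain ⟨k, hk, hk1, hk2⟩ := this
          refine (hnb x _ (hell (k+1)) hk2).trans ?_
          have e : (D0 : ℝ) * ell (k+1) = 2 * D0 * ell k := by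
            simp only [ell]; ring
          rw [e]
          refine le_trans ?_ (Finset.single_le_sum (f := fun k => {x | ((u, ell k), x) ∈ Bset}.indicator
            (fun _ => ENNReal.ofReal (2 * D0 * ell k)) x) (fun _ _ => zero_le) (Finset.mem_range.2 hk))
          rw [Set.indicator_of_mem (show x ∈ {x | ((u, ell k), x) ∈ Bset} from hk1)]
      have hBk : ∀ k, volume {x | ((u, ell k), x) ∈ Bset} ≤
          ENNReal.ofReal (D' * (K + L + 2 : ℝ) ^ n * (c / ell k) + D' * 2 ^ (K * n) * (1/2) ^ L) := by
        intro k
        refine (hGD (u, ell k)).2 K L (c / ell k) (div_nonneg hc (hell k).le) ?_ ?_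
        · rintro x ⟨hl, y, hy⟩
          exact (hfib x _ (hy y le_rfl (by linarith))).2
        · intro s' hs'
          rw [le_div_iff₀ (hell k)]
          have := hs (ell k * s') ⟨ell k, s', hell k, hs', rfl⟩
          linarith
      have hmbox : MeasurableSet {v : Fin n → ℝ | ∀ i, |v i| ≤ 2 ^ K} := by
        have : {v : Fin n → ℝ | ∀ i, |v i| ≤ 2 ^ K} = ⋂ i, {v | |v i| ≤ 2 ^ K} := by
          ext; simp
        rw [this]
        exact MeasurableSet.iInter fun i => measurableSet_le (measurable_pi_apply i).abs measurable_const
      rw [hvol]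
      refine (lintegral_mono hpt).trans ?_
      rw [lintegral_add_left (measurable_const.indicator hmbox), lintegral_finsetSum _
        (fun k _ => measurable_const.indicator (hmB _)), lintegral_indicator_const hmbox, vol_box]
      simp only [lintegral_indicator_const (hmB _)]
      have hterm : ∀ k ∈ Finset.range (K + L + 2), ENNReal.ofReal (2 * D0 * ell k) *
          volume {x | ((u, ell k), x) ∈ Bset} ≤ ENNReal.ofReal (2 * D0 * D' * (K + L + 2 : ℝ) ^ n * c +
            2 * D0 * D' * 2 ^ (K * n) * (1/2) ^ L * ell k) := by
        intro k _
        refine (mul_le_mul_right (hBk k) _).trans ?_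
        rw [← ENNReal.ofReal_mul (by have := hell k; positivity)]
        refine ENNReal.ofReal_le_ofReal (le_of_eq ?_)
        have := (hell k).ne'
        field_simp
      have hnn : ∀ k ∈ Finset.range (K + L + 2), 0 ≤ (2 * D0 * D' * (K + L + 2 : ℝ) ^ n * c +
            2 * D0 * D' * 2 ^ (K * n) * (1/2) ^ L * ell k) := fun k _ => by
        have := hell k
        positivity
      refine (add_le_add_right (Finset.sum_le_sum hterm) _).trans ?_
      rw [← ENNReal.ofReal_sum_of_nonneg hnn, ← ENNReal.ofReal_pow (by positivity),
        ← ENNReal.ofReal_mul (by positivity), ← ENNReal.ofReal_add (by positivity)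
          (Finset.sum_nonneg hnn)]
      refine ENNReal.ofReal_le_ofReal ?_
      rw [Finset.sum_add_distrib, Finset.sum_const, ← Finset.mul_sum]
      have hsum : ∑ k ∈ Finset.range (K + L + 2), ell k ≤ 4 * 2 ^ K := by
        simp only [ell]
        rw [← Finset.sum_mul, geom_sum_eq (by norm_num)]
        have : (2:ℝ) ^ (K + L + 2) * (1/2)^L = 4 * 2 ^ K := by
          rw [pow_add, pow_add, one_div, inv_pow]
          field_simp
          norm_num
        have h2 : (0:ℝ) < (1/2)^L := by positivity
        rw [show (2:ℝ) - 1 = 1 by norm_num, div_one, sub_mul, this]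
        linarith
      simp only [Finset.card_range, nsmul_eq_mul]
      push_cast
      have hK1 : (1:ℝ) ≤ 2 ^ K := one_le_pow₀ (by norm_num)
      have e1 : (2 * 2 ^ K : ℝ) ^ n = 2 ^ n * 2 ^ (K * n) := by rw [mul_pow, pow_mul]
      have e2 : (2:ℝ) ^ (K * (n+1)) = 2 ^ (K * n) * 2 ^ K := by rw [mul_add, mul_one, pow_add]
      rw [e1, e2]
      set W : ℝ := 2 ^ (K * n)
      set Q : ℝ := (1/2) ^ L
      set P : ℝ := (K + L + 2 : ℝ)
      have hW : 0 < W := by positivity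
      have hQ : 0 < Q := by positivity
      have hP : 0 ≤ P := by positivity
      have hP' : 0 ≤ P ^ (n+1) := by positivity
      have t1 : D0 * Q * (2 ^ n * W) ≤ D0 * 2 ^ n * (W * 2 ^ K) * Q := by
        have : W ≤ W * 2 ^ K := le_mul_of_one_le_right hW.le hK1
        calc (D0:ℝ) * Q * (2 ^ n * W) = D0 * 2 ^ n * W * Q := by ring
          _ ≤ _ := by gcongr
      have t2 : 2 * D0 * D' * W * Q * ∑ k ∈ Finset.range (K + L + 2), ell k ≤
          8 * D0 * D' * (W * 2 ^ K) * Q := by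
        calc _ ≤ 2 * D0 * D' * W * Q * (4 * 2 ^ K) := by gcongr
          _ = _ := by ring
      have t3 : P * (2 * D0 * D' * P ^ n * c) = 2 * D0 * D' * P ^ (n+1) * c := by ring
      rw [t3]
      have t4 : 0 ≤ (D0 * 2 ^ n + 8 * D0 * D') * P ^ (n+1) * c := by positivity
      have t5 : 0 ≤ 2 * D0 * D' * (W * 2 ^ K) * Q := by positivity
      have t6 : (2 * D0 * D' + D0 * 2 ^ n + 8 * D0 * D') * P ^ (n + 1) * c +
        (2 * D0 * D' + D0 * 2 ^ n + 8 * D0 * D') * (W * 2 ^ K) * Q =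
        2 * D0 * D' * P ^ (n+1) * c + (D0 * 2 ^ n + 8 * D0 * D') * P ^ (n+1) * c +
        (2 * D0 * D' * (W * 2 ^ K) * Q + D0 * 2 ^ n * (W * 2 ^ K) * Q + 8 * D0 * D' * (W * 2 ^ K) * Q) := by ring
      rw [t6]
      linarith

end PartP8

section PartP9

open MeasureTheory

theorem SA.exF {X : Type} [PA X] {ι : Type} (L : Finset ι) {p : ι → X → Prop}
    (h : ∀ i, SA {x | p i x}) : SA {x | ∃ i ∈ L, p i x} := by
  obtain ⟨A, h1, h2⟩ := QE.exists_max X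
  exact QE.ex_mem (SAg.isBA _) h2 L h

theorem SA.exFin {X : Type} [PA X] {n : ℕ} {p : Fin n → X → Prop}
    (h : ∀ i, SA {x | p i x}) : SA {x | ∃ i, p i x} := by
  have := SA.exF Finset.univ h
  simpa using this

theorem SA.allFin {X : Type} [PA X] {n : ℕ} {p : Fin n → X → Prop}
    (h : ∀ i, SA {x | p i x}) : SA {x | ∀ i, p i x} := by
  have := (SA.exFin (fun i => (h i).not)).not
  simpa using this

theorem summable_aux (k : ℕ) {ρ : ℝ} (h0 : 0 < ρ) (h1 : ρ < 1) :
    Summable fun j : ℕ => ((j:ℝ) + 1) ^ k * ρ ^ j := by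
  have h := summable_pow_mul_geometric_of_norm_lt_one k (r := ρ)
    (by rw [Real.norm_eq_abs, abs_of_pos h0]; exact h1)
  have h2 := ((summable_nat_add_iff 1).2 h).mul_right ρ⁻¹
  refine h2.congr fun j => ?_
  push_cast
  rw [pow_succ]
  field_simp

theorem tail_meas {n : ℕ} {S : Set (Fin n → ℝ)} (hS : MeasurableSet S) (hfin : volume S ≠ ⊤)
    {s : ℝ} (hs : 0 < s) : ∃ N : ℕ, volume (S \ {v | ∀ i, |v i| < N}) < ENNReal.ofReal s := by
  have hm : ∀ N : ℕ, MeasurableSet (S \ {v | ∀ i, |v i| < N}) := by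
    intro N
    refine hS.diff ?_
    have : {v : Fin n → ℝ | ∀ i, |v i| < N} = ⋂ i, {v : Fin n → ℝ | |v i| < (N:ℝ)} := by
      ext; simp
    rw [this]
    exact MeasurableSet.iInter fun i => measurableSet_lt (measurable_pi_apply i).abs measurable_const
  have hanti : Antitone fun N : ℕ => S \ {v : Fin n → ℝ | ∀ i, |v i| < N} := by
    intro N M hNM v hv
    refine ⟨hv.1, fun h => hv.2 fun i => (h i).trans_le (by exact_mod_cast hNM)⟩
  have hI : ⋂ N : ℕ, (S \ {v : Fin n → ℝ | ∀ i, |v i| < N}) = ∅ := by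
    ext v
    simp only [Set.mem_iInter, Set.mem_empty_iff_false, iff_false, not_forall]
    have : ∀ i, ∃ N : ℕ, |v i| < N := fun i => exists_nat_gt _
    choose f hf using this
    refine ⟨∑ i, f i, fun h => h.2 fun i => (hf i).trans_le ?_⟩
    exact_mod_cast Finset.single_le_sum (f := f) (fun _ _ => Nat.zero_le _) (Finset.mem_univ i)
  have ht := tendsto_measure_iInter_atTop (μ := volume) (fun N => (hm N).nullMeasurableSet) hanti
    ⟨0, ne_top_of_le_ne_top hfin (measure_mono Set.diff_subset)⟩
  rw [hI, measure_empty] at ht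
  have := ht.eventually (gt_mem_nhds (ENNReal.ofReal_pos.2 hs))
  exact this.exists

theorem decay {n : ℕ} {S : Set (Fin n → ℝ)} (hS : SA S) (hfin : volume S ≠ ⊤) :
    ∃ (E ρ : ℝ) (j0 : ℕ), 0 ≤ E ∧ 0 < ρ ∧ ρ < 1 ∧ ∀ j ≥ j0,
      volume {v | v ∈ S ∧ (∃ i, 2 ^ j ≤ |v i|) ∧ ∀ i, |v i| < 2 * 2 ^ j} ≤
        ENNReal.ofReal (E * ((j + 1) ^ n * ρ ^ j)) := by
  let A : Set (ℝ × (Fin n → ℝ)) := {z | z.2 ∈ S ∧ (∃ i, z.1 ≤ |z.2 i|) ∧ ∀ i, |z.2 i| < 2 * z.1}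
  have hA : SA A := by
    refine (hS.preimage Reg.id.snd).and (SA.and (SA.exFin fun i => ?_) (SA.allFin fun i => ?_))
    · simp only [le_abs]
      exact (SA.le Reg.id.fst.regF (Reg.id.snd.coord i)).or
        (SA.le Reg.id.fst.regF (Reg.id.snd.coord i).neg)
    · simp only [abs_lt]
      exact (SA.lt ((RegF.const 2).mul Reg.id.fst.regF).neg (Reg.id.snd.coord i)).and
        (SA.lt (Reg.id.snd.coord i) ((RegF.const 2).mul Reg.id.fst.regF))
  obtain ⟨G, D, hG, hGD⟩ := volV n ℝ A hA
  have hsmall : ∀ s, 0 < s → ∃ N : ℕ, ∀ t, (N:ℝ) < t → volume {v | (t, v) ∈ A} < ENNReal.ofReal s := by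
    intro s hs
    obtain ⟨N, hN⟩ := tail_meas hS.measurableSet hfin hs
    refine ⟨N, fun t ht => lt_of_le_of_lt (measure_mono ?_) hN⟩
    rintro v ⟨h1, ⟨i, h2⟩, _⟩
    refine ⟨h1, fun h => ?_⟩
    have := h i
    simp only at h2
    linarith
  have hev : ∀ s, 0 < s → ∃ T : ℝ, ∀ t, T < t → (t, s) ∉ G := by
    intro s hs
    obtain ⟨N, hN⟩ := hsmall s hs
    refine ⟨N, fun t ht hG => ?_⟩
    exact absurd ((hGD t).1 s hG).2 (not_le.2 (hN t ht))
  obtain ⟨C, m, s0, hC, hs0, hdec⟩ := asym_decay G hG hev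
  obtain ⟨N, hN⟩ := hsmall (min s0 1) (by positivity)
  let ρ : ℝ := (1/2 : ℝ) ^ (((m+1 : ℕ) : ℝ)⁻¹)
  have hρm : ρ ^ (m+1) = 1/2 := Real.rpow_inv_natCast_pow (by norm_num) (by omega)
  have hρ0 : 0 < ρ := by positivity
  have hρ1 : ρ < 1 := by
    by_contra h
    push Not at h
    have := one_le_pow₀ h (n := m+1)
    rw [hρm] at this
    norm_num at this
  have hρ2 : 1/2 ≤ ρ := by
    rw [← hρm, pow_succ]
    exact mul_le_of_le_one_left hρ0.le (pow_le_one₀ hρ0.le hρ1.le)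
  have hC1 : C ≤ (C + 1) ^ (m+1) := by
    have : C + 1 ≤ (C + 1) ^ (m+1) := le_self_pow₀ (by linarith) (by omega)
    linarith
  refine ⟨D * (n + 4) ^ n * (C + 1) + D, ρ, N, by positivity, hρ0, hρ1, fun j hj => ?_⟩
  have htj : (N:ℝ) < 2 ^ j := by
    have h1 : j < 2 ^ j := Nat.lt_two_pow_self
    have : N < 2 ^ j := by omega
    exact_mod_cast this
  have htp : (0:ℝ) < 2 ^ j := by positivity
  have hGc : ∀ s, ((2:ℝ) ^ j, s) ∈ G → s ≤ (C + 1) * ρ ^ j := by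
    intro s hs
    obtain ⟨hp, hv⟩ := (hGD _).1 s hs
    have h1 : s < min s0 1 := by
      have := hv.trans_lt (hN _ htj)
      exact (ENNReal.ofReal_lt_ofReal_iff (by positivity)).1 this
    have h2 : s < s0 := h1.trans_le (min_le_left _ _)
    have h3 : s < 1 := h1.trans_le (min_le_right _ _)
    have h4 := hdec s _ hp h2 htp hs
    have h5 : s ^ (m+1) ≤ ((C+1) * ρ ^ j) ^ (m+1) := by
      have e : (ρ ^ j) ^ (m+1) = (1/2) ^ j := by rw [← pow_mul, mul_comm, pow_mul, hρm]
      rw [mul_pow, e]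
      calc s ^ (m+1) = s ^ m * s := pow_succ _ _
        _ ≤ s ^ m * 1 := by gcongr
        _ = s ^ m := mul_one _
        _ ≤ C / 2 ^ j := h4
        _ = C * (1/2) ^ j := by rw [one_div, inv_pow]; rfl
        _ ≤ _ := by gcongr
    exact le_of_pow_le_pow_left₀ (by omega) (by positivity) h5
  have hmain := (hGD (2 ^ j)).2 (j+1) ((n+1) * (j+1)) ((C+1) * ρ ^ j) (by positivity) (by
    rintro v ⟨_, _, h⟩ i
    have := (h i).le
    simp only at this
    rw [pow_succ]; linarith) hGc
  refine hmain.trans (ENNReal.ofReal_le_ofReal ?_)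
  have e1 : (2:ℝ) ^ ((j+1) * n) * (1/2) ^ ((n+1) * (j+1)) = (1/2) ^ (j+1) := by
    have : (n+1) * (j+1) = (j+1) * n + (j+1) := by ring
    rw [this, pow_add, ← mul_assoc, ← mul_pow]
    norm_num
  have e2 : (1/2 : ℝ) ^ (j+1) ≤ ((j:ℝ)+1) ^ n * ρ ^ j := by
    calc (1/2 : ℝ) ^ (j+1) ≤ ρ ^ (j+1) := by gcongr
      _ = ρ ^ j * ρ := pow_succ _ _
      _ ≤ ρ ^ j * 1 := by gcongr
      _ = 1 * ρ ^ j := by ring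
      _ ≤ _ := by
        gcongr
        exact one_le_pow₀ (by linarith [(Nat.cast_nonneg j : (0:ℝ) ≤ j)])
  have e3 : ((((j+1 : ℕ):ℝ)) + (((n+1) * (j+1) : ℕ):ℝ) + 2) ^ n ≤ ((n:ℝ) + 4) ^ n * (j + 1) ^ n := by
    rw [← mul_pow]
    gcongr
    push_cast
    nlinarith [(Nat.cast_nonneg j : (0:ℝ) ≤ j)]
  rw [mul_assoc (D:ℝ) (2 ^ _), e1]
  calc _ ≤ (D:ℝ) * (((n:ℝ) + 4) ^ n * (j + 1) ^ n) * ((C + 1) * ρ ^ j) + D * (((j:ℝ)+1) ^ n * ρ ^ j) := by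
        gcongr
    _ = _ := by ring

theorem tail_bound {n : ℕ} {S : Set (Fin n → ℝ)} (hS : SA S) (hfin : volume S ≠ ⊤) :
    ∃ C : ℝ, 0 ≤ C ∧ ∀ J : ℕ,
      volume (S \ {v | ∀ i, |v i| < 2 ^ J}) ≤ ENNReal.ofReal (C / (J + 1)) := by
  obtain ⟨E, ρ, j0, hE, hρ0, hρ1, hdec⟩ := decay hS hfin
  let a : ℕ → ℝ := fun j => E * (((j:ℝ) + 1) ^ n * ρ ^ j)
  have ha0 : ∀ j, 0 ≤ a j := fun j => by positivity
  have hsum : Summable fun j : ℕ => ((j:ℝ) + 1) * a j := by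
    refine ((summable_aux (n+1) hρ0 hρ1).mul_left E).congr fun j => ?_
    simp only [a]; ring
  set T0 := ∑' j : ℕ, ((j:ℝ) + 1) * a j
  have hT0 : 0 ≤ T0 := tsum_nonneg fun j => by have := ha0 j; positivity
  set V := (volume S).toReal
  have hV : 0 ≤ V := ENNReal.toReal_nonneg
  refine ⟨T0 + V * (j0 + 1), by positivity, fun J => ?_⟩
  by_cases hJ : J < j0
  · calc volume (S \ {v | ∀ i, |v i| < 2 ^ J}) ≤ volume S := measure_mono Set.diff_subset
      _ = ENNReal.ofReal V := (ENNReal.ofReal_toReal hfin).symm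
      _ ≤ _ := by
        refine ENNReal.ofReal_le_ofReal ?_
        rw [le_div_iff₀ (by positivity)]
        have : (J:ℝ) ≤ j0 := by exact_mod_cast hJ.le
        have : V * ((J:ℝ) + 1) ≤ V * (j0 + 1) := by gcongr
        linarith
  push Not at hJ
  have hsub : S \ {v | ∀ i, |v i| < 2 ^ J} ⊆
      ⋃ j : ℕ, {v | v ∈ S ∧ (∃ i, 2 ^ (j + J) ≤ |v i|) ∧ ∀ i, |v i| < 2 * 2 ^ (j + J)} := by
    rintro v ⟨hv, hv2⟩
    have hv2' : ∃ i, 2 ^ J ≤ |v i| := by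
      by_contra h
      push Not at h
      exact hv2 h
    obtain ⟨i0, hi0⟩ := hv2'
    obtain ⟨i, _, hi⟩ := Finset.exists_max_image Finset.univ (fun i => |v i|) ⟨i0, Finset.mem_univ _⟩
    have hM : (2:ℝ) ^ J ≤ |v i| := hi0.trans (hi i0 (Finset.mem_univ _))
    have hM1 : 1 ≤ |v i| := (one_le_pow₀ (by norm_num)).trans hM
    obtain ⟨k, hk1, hk2⟩ := exists_nat_pow_near hM1 (by norm_num : (1:ℝ) < 2)
    have hJk : J ≤ k := by
      have : (2:ℝ) ^ J < 2 ^ (k+1) := hM.trans_lt hk2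
      have := (pow_lt_pow_iff_right₀ (by norm_num : (1:ℝ) < 2)).1 this
      omega
    refine Set.mem_iUnion.2 ⟨k - J, hv, ?_⟩
    rw [Nat.sub_add_cancel hJk]
    refine ⟨⟨i, hk1⟩, fun i' => (hi i' (Finset.mem_univ _)).trans_lt ?_⟩
    rw [pow_succ] at hk2; linarith
  have hsa : Summable fun j => a (j + J) := by
    refine Summable.of_nonneg_of_le (fun j => ha0 _) (fun j => ?_) ((summable_nat_add_iff J).2 hsum)
    have := ha0 (j + J)
    refine le_mul_of_one_le_left this ?_
    have : (0:ℝ) ≤ ((j + J : ℕ) : ℝ) := Nat.cast_nonneg _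
    linarith
  calc volume (S \ {v | ∀ i, |v i| < 2 ^ J}) ≤ _ := measure_mono hsub
    _ ≤ ∑' j : ℕ, volume {v | v ∈ S ∧ (∃ i, 2 ^ (j + J) ≤ |v i|) ∧ ∀ i, |v i| < 2 * 2 ^ (j + J)} :=
        measure_iUnion_le _
    _ ≤ ∑' j : ℕ, ENNReal.ofReal (a (j + J)) := by
        refine ENNReal.tsum_le_tsum fun j => ?_
        have := hdec (j + J) (by omega)
        simpa [a] using this
    _ = ENNReal.ofReal (∑' j : ℕ, a (j + J)) := (ENNReal.ofReal_tsum_of_nonneg (fun j => ha0 _) hsa).symm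
    _ ≤ _ := by
        refine ENNReal.ofReal_le_ofReal ?_
        rw [le_div_iff₀ (by positivity), ← tsum_mul_right]
        have h1 : ∑' j : ℕ, a (j + J) * ((J:ℝ) + 1) ≤ ∑' j : ℕ, (((j + J : ℕ):ℝ) + 1) * a (j + J) := by
          refine Summable.tsum_le_tsum (fun j => ?_) (hsa.mul_right _) ((summable_nat_add_iff J).2 hsum)
          have := ha0 (j + J)
          push_cast
          have : (0:ℝ) ≤ j := Nat.cast_nonneg _
          nlinarith
        have h2 : ∑' j : ℕ, (((j + J : ℕ):ℝ) + 1) * a (j + J) ≤ T0 := by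
          have := hsum.sum_add_tsum_nat_add J
          have h3 : 0 ≤ ∑ j ∈ Finset.range J, ((j:ℝ) + 1) * a j :=
            Finset.sum_nonneg fun j _ => by have := ha0 j; positivity
          simp only [T0]
          linarith
        have h3 : 0 ≤ V * (j0 + 1) := by positivity
        linarith

end PartP9

section PartP10

open MeasureTheory

open Classical in
theorem grid_one {S : Set ℝ} (hm : MeasurableSet S) (F : Finset ℝ)
    (hS : ∀ y y', (∀ a ∈ F, a ∉ Set.uIcc y y') → (y ∈ S ↔ y' ∈ S)) (c h : ℝ) (hh : 0 ≤ h) (B : ℕ) :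
    |(volume (S ∩ Set.Ico c (c + B * h))).toReal - h * ∑ i ∈ Finset.range B,
        (if c + i * h ∈ S then (1:ℝ) else 0)| ≤
      h * (F.filter (fun a => a ∈ Set.Ico c (c + B * h))).card := by
  induction B with
  | zero => simp
  | succ B ih =>
    set q := c + B * h with hq
    have hq1 : c + ((B + 1 : ℕ) : ℝ) * h = q + h := by push_cast; ring
    rw [hq1]
    have hcq : c ≤ q := by have : 0 ≤ B * h := by positivity
                           linarith
    have hqh : q ≤ q + h := by linarith
    have hU : Set.Ico c (q + h) = Set.Ico c q ∪ Set.Ico q (q + h) :=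
      (Set.Ico_union_Ico_eq_Ico hcq hqh).symm
    have hdis : Disjoint (Set.Ico c q) (Set.Ico q (q + h)) := by
      rw [Set.disjoint_left]; rintro x ⟨_, h1⟩ ⟨h2, _⟩; linarith
    have hfin : ∀ a b : ℝ, volume (S ∩ Set.Ico a b) ≠ ⊤ := fun a b =>
      ne_top_of_le_ne_top (by simp) (measure_mono Set.inter_subset_right)
    have hv : (volume (S ∩ Set.Ico c (q + h))).toReal = (volume (S ∩ Set.Ico c q)).toReal +
        (volume (S ∩ Set.Ico q (q+h))).toReal := by
      rw [hU, Set.inter_union_distrib_left, measure_union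
        (hdis.mono Set.inter_subset_right Set.inter_subset_right) (hm.inter measurableSet_Ico),
        ENNReal.toReal_add (hfin _ _) (hfin _ _)]
    have hcard : (F.filter (fun a => a ∈ Set.Ico c (q + h))).card =
        (F.filter (fun a => a ∈ Set.Ico c q)).card + (F.filter (fun a => a ∈ Set.Ico q (q+h))).card := by
      rw [← Finset.card_union_of_disjoint, ← Finset.filter_or]
      · congr 1
        refine Finset.filter_congr fun a _ => ?_
        rw [hU]; rfl
      · exact Finset.disjoint_filter.2 fun a _ h1 h2 => Set.disjoint_left.1 hdis h1 h2
    have hloc : |(volume (S ∩ Set.Ico q (q+h))).toReal - h * (if q ∈ S then (1:ℝ) else 0)| ≤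
        h * (F.filter (fun a => a ∈ Set.Ico q (q+h))).card := by
      by_cases he : ∃ a ∈ F, a ∈ Set.Ico q (q+h)
      · obtain ⟨a, ha, ha'⟩ := he
        have h1 : (1:ℝ) ≤ (F.filter (fun a => a ∈ Set.Ico q (q+h))).card := by
          exact_mod_cast Finset.card_pos.2 ⟨a, Finset.mem_filter.2 ⟨ha, ha'⟩⟩
        have h2 : (volume (S ∩ Set.Ico q (q+h))).toReal ≤ h := by
          refine ENNReal.toReal_le_of_le_ofReal hh ?_
          refine (measure_mono Set.inter_subset_right).trans ?_
          simp
        have h3 : 0 ≤ (volume (S ∩ Set.Ico q (q+h))).toReal := ENNReal.toReal_nonneg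
        refine le_trans ?_ (le_mul_of_one_le_right hh h1)
        rw [abs_le]
        split_ifs <;> constructor <;> linarith
      · push Not at he
        have hiff : ∀ y ∈ Set.Ico q (q+h), (q ∈ S ↔ y ∈ S) := by
          intro y hy
          refine hS q y fun a ha ha' => he a ha ?_
          rw [Set.uIcc_of_le hy.1] at ha'
          exact ⟨ha'.1, ha'.2.trans_lt hy.2⟩
        have : (volume (S ∩ Set.Ico q (q+h))).toReal - h * (if q ∈ S then (1:ℝ) else 0) = 0 := by
          by_cases hqS : q ∈ S
          · have : S ∩ Set.Ico q (q+h) = Set.Ico q (q+h) :=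
              Set.inter_eq_right.2 fun y hy => (hiff y hy).1 hqS
            rw [this]; simp [hqS, hh]
          · have : S ∩ Set.Ico q (q+h) = ∅ := by
              ext y
              simp only [Set.mem_inter_iff, Set.mem_empty_iff_false, iff_false, not_and]
              exact fun h1 h2 => hqS ((hiff y h2).2 h1)
            rw [this]; simp [hqS]
        rw [this, abs_zero]; positivity
    rw [hv, hcard, Finset.sum_range_succ, ← hq]
    push_cast
    rw [mul_add, mul_add]
    refine le_trans ?_ (add_le_add ih hloc)
    refine le_trans (le_of_eq ?_) (abs_add_le _ _)
    congr 1; ring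

open Classical in
/-- number of grid points in a set -/
noncomputable def cnt : (n : ℕ) → ℕ → (ℕ → ℝ) → Set (Fin n → ℝ) → ℝ
  | 0, _, _, A => if (default : Fin 0 → ℝ) ∈ A then 1 else 0
  | n+1, B, g, A => ∑ i ∈ Finset.range B, cnt n B g {x | (Fin.cons (g i) x : Fin (n+1) → ℝ) ∈ A}

/-- half-open box -/
def hbox (n : ℕ) (R : ℝ) : Set (Fin n → ℝ) := {v | ∀ i, v i ∈ Set.Ico (-R) R}

theorem hbox_eq (n : ℕ) (R : ℝ) : hbox n R = Set.pi Set.univ fun _ => Set.Ico (-R) R := by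
  ext v; simp [hbox]

theorem hbox_meas (n : ℕ) (R : ℝ) : MeasurableSet (hbox n R) := by
  rw [hbox_eq]; exact MeasurableSet.univ_pi fun _ => measurableSet_Ico

theorem hbox_vol (n : ℕ) (R : ℝ) : volume (hbox n R) = ENNReal.ofReal (2 * R) ^ n := by
  rw [hbox_eq, volume_pi_pi]; simp [← two_mul]

theorem hbox_cons {n : ℕ} {R y : ℝ} {x : Fin n → ℝ} :
    (Fin.cons y x : Fin (n+1) → ℝ) ∈ hbox (n+1) R ↔ y ∈ Set.Ico (-R) R ∧ x ∈ hbox n R := by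
  simp only [hbox, Set.mem_setOf_eq, Fin.forall_fin_succ, Fin.cons_zero, Fin.cons_succ]

open Classical in
theorem grid (n : ℕ) : ∀ (X : Type) [PA X] (A : Set (X × (Fin n → ℝ))), SA A →
    ∃ D : ℕ, ∀ (u : X) (R h : ℝ) (B : ℕ), 0 ≤ R → 0 ≤ h → B * h = 2 * R →
      |(volume ({v | (u, v) ∈ A} ∩ hbox n R)).toReal -
        h ^ n * cnt n B (fun i => -R + i * h) {v | (u, v) ∈ A}| ≤ D * h * (1 + 2 * R) ^ n := by
  induction n with
  | zero =>
    intro X _ A hA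
    refine ⟨0, fun u R h B _ _ _ => ?_⟩
    have hb : hbox 0 R = Set.univ := by ext v; simp [hbox]
    have hvol : volume (Set.univ : Set (Fin 0 → ℝ)) = 1 := by simp [volume_pi]
    rw [hb, Set.inter_univ, cnt]
    by_cases hu : (u, (default : Fin 0 → ℝ)) ∈ A
    · have : {v : Fin 0 → ℝ | (u, v) ∈ A} = Set.univ := by
        ext v; rw [Subsingleton.elim v default]; simpa using hu
      rw [this, hvol]; simp
    · have : {v : Fin 0 → ℝ | (u, v) ∈ A} = ∅ := by
        ext v; rw [Subsingleton.elim v default]; simpa using hu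
      rw [this]; simp
  | succ n ih =>
    intro X _ A hA
    let A' : Set ((X × (Fin n → ℝ)) × ℝ) := {z | (z.1.1, (Fin.cons z.2 z.1.2 : Fin (n+1) → ℝ)) ∈ A}
    have hA' : SA A' := by
      refine hA.preimage (Reg.mk Reg.id.fst.fst (Reg.pi fun i => ?_))
      refine Fin.cases ?_ (fun j => ?_) i
      · simpa using Reg.id.snd.regF
      · simpa using Reg.id.fst.snd.coord j
    obtain ⟨D0, hD0⟩ := hA'.fiber_finite
    let A2 : Set ((X × ℝ) × (Fin n → ℝ)) := {z | ((z.1.1, z.2), z.1.2) ∈ A'}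
    have hA2 : SA A2 := hA'.preimage (Reg.mk (Reg.mk Reg.id.fst.fst Reg.id.snd) Reg.id.fst.snd)
    obtain ⟨D', hD'⟩ := ih (X × ℝ) A2 hA2
    refine ⟨D0 + D', fun u R h B hR hh hB => ?_⟩
    have hmA : MeasurableSet {v | (u, v) ∈ A} :=
      (hA.preimage (Reg.mk (Reg.const u) Reg.id)).measurableSet
    have hm2 : ∀ y, MeasurableSet {x | ((u, y), x) ∈ A2} := fun y =>
      (hA2.preimage (Reg.mk (Reg.const (u, y)) Reg.id)).measurableSet
    have hcm : Measurable fun z : (Fin n → ℝ) × ℝ => (Fin.cons z.2 z.1 : Fin (n+1) → ℝ) := by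
      refine measurable_pi_lambda _ fun i => ?_
      refine Fin.cases ?_ (fun j => ?_) i
      · simpa using measurable_snd
      · simpa [Function.comp_def] using (measurable_pi_apply j).comp (measurable_fst (α := Fin n → ℝ) (β := ℝ))
    let T : Set ((Fin n → ℝ) × ℝ) := {z | ((u, z.1), z.2) ∈ A' ∧ z.2 ∈ Set.Ico (-R) R}
    have hT : MeasurableSet T := (hcm hmA).inter (measurable_snd measurableSet_Ico)
    let φ : (Fin n → ℝ) → ENNReal := fun x => volume ({y | ((u, x), y) ∈ A'} ∩ Set.Ico (-R) R)
    have hφm : Measurable φ := measurable_measure_prodMk_left hT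
    have hφb : ∀ x, φ x ≤ ENNReal.ofReal (2 * R) := by
      intro x
      refine (measure_mono Set.inter_subset_right).trans ?_
      simp [two_mul]
    have hvol : volume ({v | (u, v) ∈ A} ∩ hbox (n+1) R) = ∫⁻ x in hbox n R, φ x := by
      rw [vol_fubini (hmA.inter (hbox_meas _ _)), ← lintegral_indicator (hbox_meas _ _)]
      refine lintegral_congr fun x => ?_
      by_cases hx : x ∈ hbox n R
      · rw [Set.indicator_of_mem hx]
        congr 1
        ext y
        simp only [Set.mem_inter_iff, Set.mem_setOf_eq, hbox_cons, hx, and_true]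
        rfl
      · rw [Set.indicator_of_notMem hx]
        have : {y : ℝ | (Fin.cons y x : Fin (n+1) → ℝ) ∈ {v | (u, v) ∈ A} ∩ hbox (n+1) R} = ∅ := by
          ext y
          simp [hbox_cons, hx]
        rw [this]; simp
    have hbfin : volume (hbox n R) < ⊤ := by
      rw [hbox_vol]; exact ENNReal.pow_lt_top ENNReal.ofReal_lt_top
    have hbreal : (volume.real (hbox n R)) = (2 * R) ^ n := by
      rw [Measure.real, hbox_vol, ENNReal.toReal_pow, ENNReal.toReal_ofReal (by positivity)]
    have hvolr : (volume ({v | (u, v) ∈ A} ∩ hbox (n+1) R)).toReal =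
        ∫ x in hbox n R, (φ x).toReal := by
      rw [hvol, integral_toReal hφm.aemeasurable]
      exact Filter.Eventually.of_forall fun x => (hφb x).trans_lt ENNReal.ofReal_lt_top
    let ψ : ℕ → (Fin n → ℝ) → ℝ := fun i => {x | ((u, -R + i * h), x) ∈ A2}.indicator fun _ => 1
    have hψi : ∀ i, IntegrableOn (ψ i) (hbox n R) := fun i =>
      (integrableOn_const hbfin.ne).indicator (hm2 _)
    have hψ : ∀ i, ∫ x in hbox n R, ψ i x =
        (volume ({x | ((u, -R + i * h), x) ∈ A2} ∩ hbox n R)).toReal := by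
      intro i
      rw [integral_indicator_const _ (hm2 _), Measure.real, Measure.restrict_apply (hm2 _)]
      simp
    have hφi : IntegrableOn (fun x => (φ x).toReal) (hbox n R) := by
      refine Measure.integrableOn_of_bounded (M := 2 * R) hbfin.ne hφm.ennreal_toReal.aestronglyMeasurable ?_
      refine Filter.Eventually.of_forall fun x => ?_
      rw [Real.norm_eq_abs, abs_of_nonneg ENNReal.toReal_nonneg]
      exact ENNReal.toReal_le_of_le_ofReal (by positivity) (hφb x)
    have hpt : ∀ x, ‖(φ x).toReal - h * ∑ i ∈ Finset.range B, ψ i x‖ ≤ D0 * h := by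
      intro x
      obtain ⟨F, hF, hF'⟩ := hD0 (u, x)
      have hmx : MeasurableSet {y | ((u, x), y) ∈ A'} :=
        (hcm.comp (measurable_prodMk_left (x := x))) hmA
      have := grid_one hmx F hF' (-R) h hh B
      rw [hB, show -R + 2 * R = R by ring] at this
      rw [Real.norm_eq_abs]
      have e : ∀ i, ψ i x = if -R + i * h ∈ {y | ((u, x), y) ∈ A'} then (1:ℝ) else 0 := by
        intro i
        simp only [ψ, Set.indicator_apply]
        rfl
      simp only [e]
      refine this.trans ?_
      rw [mul_comm]
      gcongr
      exact (Finset.card_filter_le _ _).trans hF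
    have hint : |(volume ({v | (u, v) ∈ A} ∩ hbox (n+1) R)).toReal - h * ∑ i ∈ Finset.range B,
        (volume ({x | ((u, -R + i * h), x) ∈ A2} ∩ hbox n R)).toReal| ≤ D0 * h * (2 * R) ^ n := by
      rw [hvolr]
      simp only [← hψ]
      rw [← integral_finset_sum _ fun i _ => hψi i, ← integral_const_mul, ← integral_sub hφi
        ((integrable_finset_sum _ fun i _ => hψi i).const_mul h), ← Real.norm_eq_abs, ← hbreal]
      exact norm_setIntegral_le_of_norm_le_const hbfin fun x _ => hpt x
    have hrec : |h * ∑ i ∈ Finset.range B,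
        (volume ({x | ((u, -R + i * h), x) ∈ A2} ∩ hbox n R)).toReal -
        h ^ (n+1) * cnt (n+1) B (fun i => -R + i * h) {v | (u, v) ∈ A}| ≤
          2 * R * (D' * h * (1 + 2 * R) ^ n) := by
      rw [cnt, pow_succ', mul_assoc, ← mul_sub, Finset.mul_sum _ _ (h ^ n), ← Finset.sum_sub_distrib, abs_mul, abs_of_nonneg hh]
      rw [show 2 * R * (D' * h * (1 + 2 * R) ^ n) = h * (B * (D' * h * (1 + 2 * R) ^ n)) by
        rw [← mul_assoc h, mul_comm h, hB]]
      gcongr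
      refine (Finset.abs_sum_le_sum_abs _ _).trans ?_
      refine (Finset.sum_le_card_nsmul _ _ (D' * h * (1 + 2 * R) ^ n) fun i _ => ?_).trans ?_
      · exact hD' (u, -R + i * h) R h B hR hh hB
      · simp
    calc _ ≤ D0 * h * (2 * R) ^ n + 2 * R * (D' * h * (1 + 2 * R) ^ n) := by
          refine le_trans ?_ (add_le_add hint hrec)
          exact abs_sub_le _ _ _
      _ ≤ D0 * h * (1 + 2 * R) ^ n + 2 * R * (D' * h * (1 + 2 * R) ^ n) := by
          gcongr; linarith
      _ ≤ _ := by
          push_cast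
          rw [pow_succ]
          have h1 : 0 ≤ D0 * h * (1 + 2 * R) ^ n * (2 * R) := by positivity
          have h2 : 0 ≤ D' * h * (1 + 2 * R) ^ n := by positivity
          nlinarith

end PartP10

section PartP11

open MeasureTheory

/-- uniform primitive recursive decidability of membership at rational points -/
def Dec {α : Type} [Primcodable α] {n : ℕ} (A : α → Set (Fin n → ℝ)) : Prop :=
  ∀ (β : Type) [Primcodable β] (φ : β → α), Primrec φ → ∀ pts : Fin n → β → ℝ, (∀ i, RP (pts i)) →
    PrimrecPred fun b => (fun i => pts i b) ∈ A (φ b)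

theorem cnt_RP (n : ℕ) : ∀ (α : Type) [Primcodable α] (A : α → Set (Fin n → ℝ)) (B : α → ℕ)
    (g : α × ℕ → ℝ), Dec A → Primrec B → RP g → RP fun a => cnt n (B a) (fun i => g (a, i)) (A a) := by
  induction n with
  | zero =>
    intro α _ A B g hA hB hg
    simp only [cnt]
    classical
    refine (RP.ind (p := fun a => (default : Fin 0 → ℝ) ∈ A a) ((hA α id Primrec.id (fun i => i.elim0) fun i => i.elim0).of_eq fun a => ?_)).of_eq fun a => ?_
    · rw [Subsingleton.elim (fun i : Fin 0 => _) (default : Fin 0 → ℝ)]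
      rfl
    · congr
  | succ n ih =>
    intro α _ A B g hA hB hg
    simp only [cnt]
    have := ih (α × ℕ) (fun z => {x | (Fin.cons (g z) x : Fin (n+1) → ℝ) ∈ A z.1}) (fun z => B z.1)
      (fun z => g (z.1.1, z.2)) ?_ (hB.comp Primrec.fst)
      (hg.comp (Primrec.pair (Primrec.fst.comp Primrec.fst) Primrec.snd))
    · exact RP.sum this hB
    · intro β _ φ hφ pts hpts
      have := hA β (fun b => (φ b).1) (Primrec.fst.comp hφ)
        (Fin.cons (fun b => g (φ b)) pts : Fin (n+1) → β → ℝ) (fun i => by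
          refine Fin.cases ?_ (fun j => ?_) i
          · exact hg.comp hφ
          · exact hpts j)
      refine this.of_eq fun b => ?_
      have e : (fun i => (Fin.cons (fun b => g (φ b)) pts : Fin (n+1) → β → ℝ) i b) =
          (Fin.cons (g (φ b)) (fun i => pts i b) : Fin (n+1) → ℝ) := by
        funext i
        refine Fin.cases ?_ (fun j => ?_) i <;> rfl
      rw [e]; rfl

/-- semialgebraic sets over the rationals -/
def Nice {n : ℕ} (A : Set (Fin n → ℝ)) : Prop := SA A ∧ Dec fun _ : Unit => A

theorem Nice.pos {n : ℕ} (p : MvPolynomial (Fin n) ℚ) :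
    Nice {v : Fin n → ℝ | 0 < MvPolynomial.aeval v p} := by
  constructor
  · have : RegF fun v : Fin n → ℝ => MvPolynomial.aeval v p := by
      induction p using MvPolynomial.induction_on with
      | C a => simpa using RegF.const _
      | add p q hp hq => simpa using hp.add hq
      | mul_X p i hp => simpa using hp.mul (Reg.id.coord i)
    exact SA.lt (RegF.const 0) this
  · intro β _ φ _ pts hpts
    have : RP fun b => MvPolynomial.aeval (fun i => pts i b) p := by
      induction p using MvPolynomial.induction_on with
      | C a => simpa using RP.constRat a
      | add p q hp hq => simpa using hp.add hq
      | mul_X p i hp => simpa using hp.mul (hpts i)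
    exact this.pos

theorem Nice.compl {n : ℕ} {A : Set (Fin n → ℝ)} (h : Nice A) : Nice {v | v ∉ A} :=
  ⟨h.1.not, fun β _ φ hφ pts hpts => (h.2 β φ hφ pts hpts).not⟩

theorem Nice.inter {n : ℕ} {A B : Set (Fin n → ℝ)} (h : Nice A) (h' : Nice B) :
    Nice {v | v ∈ A ∧ v ∈ B} :=
  ⟨h.1.and h'.1, fun β _ φ hφ pts hpts => (h.2 β φ hφ pts hpts).and (h'.2 β φ hφ pts hpts)⟩

theorem Nice.list {n : ℕ} (ps : List (MvPolynomial (Fin n) ℚ)) :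
    Nice {v : Fin n → ℝ | ∀ P ∈ ps, 0 ≤ MvPolynomial.aeval v P} := by
  induction ps with
  | nil =>
    have := Nice.pos (n := n) 1
    simpa using this
  | cons p ps ih =>
    have := (Nice.pos (-p)).compl.inter ih
    simpa using this

theorem vol_approx {n : ℕ} {A : Set (Fin n → ℝ)} (hA : Nice A) (hfin : volume A ≠ ⊤) :
    ∃ (r : ℕ → ℝ) (C : ℝ), RP r ∧ 0 ≤ C ∧ ∀ k : ℕ, |(volume A).toReal - r k| ≤ C / ((k:ℝ) + 1) := by
  obtain ⟨C, hC, htail⟩ := tail_bound hA.1 hfin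
  obtain ⟨D, hD⟩ := grid n ℝ {z : ℝ × (Fin n → ℝ) | z.2 ∈ A} (hA.1.preimage Reg.id.snd)
  let m : ℕ → ℕ := fun k => 2 ^ ((n+1) * (k+2))
  have hm : Primrec m := primrec_nat_pow.comp (Primrec.const 2)
    (Primrec.nat_mul.comp (Primrec.const _) (Primrec.nat_add.comp Primrec.id (Primrec.const 2)))
  have hm0 : ∀ k, 0 < m k := fun k => by positivity
  have h2k : Primrec fun k : ℕ => 2 ^ k := primrec_nat_pow.comp (Primrec.const 2) Primrec.id
  let B : ℕ → ℕ := fun k => 2 * 2 ^ k * m k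
  have hB : Primrec B := Primrec.nat_mul.comp (Primrec.nat_mul.comp (Primrec.const 2) h2k) hm
  have hh : RP fun k => 1 / (m k : ℝ) := RP.invNat hm hm0
  have hhn : ∀ j : ℕ, RP fun k => (1 / (m k : ℝ)) ^ j := by
    intro j
    induction j with
    | zero => simpa using RP.constRat (α := ℕ) 1
    | succ j ih => simpa only [pow_succ] using ih.mul hh
  have hg : RP fun z : ℕ × ℕ => -((2 ^ z.1 : ℕ) : ℝ) + z.2 * (1 / (m z.1 : ℝ)) :=
    (RP.natCast (h2k.comp Primrec.fst)).neg.add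
      ((RP.natCast Primrec.snd).mul (hh.comp Primrec.fst))
  have hcnt := cnt_RP n ℕ (fun _ => A) B _ (fun β _ φ hφ pts hpts =>
    hA.2 β (fun _ => ()) (Primrec.const _) pts hpts) hB hg
  refine ⟨_, C + D, (hhn n).mul hcnt, by positivity, fun k => ?_⟩
  simp only
  have hmk : (0:ℝ) < m k := by exact_mod_cast hm0 k
  have h1 := hD 0 (2 ^ k) (1 / (m k : ℝ)) (B k) (by positivity) (by positivity) (by
    simp only [B]; push_cast; field_simp)
  simp only [Set.mem_setOf_eq] at h1
  have e1 : ((2 ^ k : ℕ) : ℝ) = 2 ^ k := by push_cast; rfl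
  rw [e1]
  have hV : |(volume A).toReal - (volume (A ∩ hbox n (2 ^ k))).toReal| ≤ C / (k + 1) := by
    have h2 : volume A = volume (A ∩ hbox n (2 ^ k)) + volume (A \ hbox n (2 ^ k)) :=
      (measure_inter_add_diff _ (hbox_meas _ _)).symm
    have h3 : volume (A \ hbox n (2 ^ k)) ≤ ENNReal.ofReal (C / (k + 1)) := by
      refine (measure_mono ?_).trans (htail k)
      refine Set.diff_subset_diff_right fun v hv i => ?_
      have := abs_lt.1 (hv i)
      exact ⟨this.1.le, this.2⟩
    rw [h2, ENNReal.toReal_add (ne_top_of_le_ne_top hfin (measure_mono Set.inter_subset_left))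
      (ne_top_of_le_ne_top hfin (measure_mono Set.diff_subset)), add_sub_cancel_left,
      abs_of_nonneg ENNReal.toReal_nonneg]
    exact ENNReal.toReal_le_of_le_ofReal (by positivity) h3
  have hE : D * (1 / (m k : ℝ)) * (1 + 2 * 2 ^ k) ^ n ≤ D / ((k:ℝ) + 1) := by
    have hk1 : (1:ℝ) ≤ 2 ^ k := one_le_pow₀ (by norm_num)
    have h4 : (1 + 2 * 2 ^ k : ℝ) ^ n ≤ (2 ^ (k+2)) ^ n := by
      gcongr
      rw [pow_add]; linarith
    have h5 : (m k : ℝ) = 2 ^ (k+2) * (2 ^ (k+2)) ^ n := by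
      simp only [m]
      push_cast
      rw [← pow_mul, ← pow_add]; congr 1; ring
    have h6 : (k:ℝ) + 1 ≤ 2 ^ (k+2) := by
      have : k + 2 < 2 ^ (k+2) := Nat.lt_two_pow_self
      have : k + 1 ≤ 2 ^ (k+2) := by omega
      exact_mod_cast this
    calc D * (1 / (m k : ℝ)) * (1 + 2 * 2 ^ k) ^ n ≤ D * (1 / (m k : ℝ)) * (2 ^ (k+2)) ^ n := by gcongr
      _ = D / 2 ^ (k+2) := by rw [h5]; field_simp
      _ ≤ _ := by gcongr
  rw [add_div]
  exact (abs_sub_le _ _ _).trans (add_le_add hV (h1.trans hE))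

theorem part_approx {n : ℕ} (f g : MvPolynomial (Fin n) ℚ) (ps : List (MvPolynomial (Fin n) ℚ))
    (hfin : ∫⁻ v in {v : Fin n → ℝ | ∀ P ∈ ps, 0 ≤ (MvPolynomial.aeval v) P},
      ENNReal.ofReal ((MvPolynomial.aeval v) f / (MvPolynomial.aeval v) g) ≠ ⊤) :
    ∃ (r : ℕ → ℝ) (C : ℝ), RP r ∧ 0 ≤ C ∧ ∀ k : ℕ,
      |(∫⁻ v in {v : Fin n → ℝ | ∀ P ∈ ps, 0 ≤ (MvPolynomial.aeval v) P},
      ENNReal.ofReal ((MvPolynomial.aeval v) f / (MvPolynomial.aeval v) g)).toReal - r k| ≤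
        C / ((k:ℝ) + 1) := by
  set S := {v : Fin n → ℝ | ∀ P ∈ ps, 0 ≤ (MvPolynomial.aeval v) P} with hS
  let f' := MvPolynomial.rename Fin.succ f
  let g' := MvPolynomial.rename Fin.succ g
  let A : Set (Fin (n+1) → ℝ) := {w | w ∈ {w | ∀ P ∈ ps.map (MvPolynomial.rename Fin.succ),
      0 ≤ MvPolynomial.aeval w P} ∧ w ∈ {w | w ∈ {w | 0 < MvPolynomial.aeval w
        (MvPolynomial.X 0 : MvPolynomial (Fin (n+1)) ℚ)} ∧
      w ∈ {w | 0 < MvPolynomial.aeval w (f' * g' - MvPolynomial.X 0 * g' ^ 2)}}}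
  have hA : Nice A := (Nice.list _).inter ((Nice.pos _).inter (Nice.pos _))
  have hmS : MeasurableSet S := (Nice.list ps).1.measurableSet
  have hvol : volume A = ∫⁻ v in S,
      ENNReal.ofReal ((MvPolynomial.aeval v) f / (MvPolynomial.aeval v) g) := by
    rw [vol_fubini hA.1.measurableSet, ← lintegral_indicator hmS]
    refine lintegral_congr fun x => ?_
    have hc : ∀ y, (Fin.cons y x : Fin (n+1) → ℝ) ∘ Fin.succ = x := fun y => by
      funext i; simp
    have hmem : ∀ y, (Fin.cons y x : Fin (n+1) → ℝ) ∈ A ↔ x ∈ S ∧ 0 < y ∧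
        y < (MvPolynomial.aeval x) f / (MvPolynomial.aeval x) g := by
      intro y
      simp only [A, f', g', hS, Set.mem_setOf_eq, List.forall_mem_map, MvPolynomial.aeval_rename, hc,
        MvPolynomial.aeval_X, Fin.cons_zero, map_sub, map_mul, map_pow]
      refine and_congr_right fun _ => and_congr_right fun hy => ?_
      set a := (MvPolynomial.aeval x) f
      set b := (MvPolynomial.aeval x) g
      by_cases hb : b = 0
      · simp [hb, hy.le]
      · have hb2 : 0 < b ^ 2 := by positivity
        have : a / b = a * b / b ^ 2 := by field_simp
        rw [this, lt_div_iff₀ hb2, sub_pos]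
    simp only [hmem]
    by_cases hx : x ∈ S
    · rw [Set.indicator_of_mem hx]
      simp only [hx, true_and]
      have := Real.volume_Ioo (a := 0) (b := (MvPolynomial.aeval x) f / (MvPolynomial.aeval x) g)
      rw [sub_zero] at this
      exact this
    · rw [Set.indicator_of_notMem hx]
      simp [hx]
  rw [← hvol] at hfin ⊢
  exact vol_approx hA hfin

theorem period_approx {x : ℝ} (hx : IsPeriod x) : ∃ (r : ℕ → ℝ) (C : ℕ), RP r ∧
    ∀ k : ℕ, |x - r k| ≤ C / ((k:ℝ) + 1) := by
  obtain ⟨n, f, g, ps, hint, rfl⟩ := hx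
  have hneg : ∀ v : Fin n → ℝ, -((MvPolynomial.aeval v) f / (MvPolynomial.aeval v) g) =
      (MvPolynomial.aeval v) (-f) / (MvPolynomial.aeval v) g := fun v => by
    rw [map_neg, neg_div]
  obtain ⟨r1, C1, hr1, hC1, h1⟩ := part_approx f g ps hint.lintegral_lt_top.ne
  have hint2 := hint.neg
  obtain ⟨r2, C2, hr2, hC2, h2⟩ := part_approx (-f) g ps (by
    have := (Integrable.neg hint).lintegral_lt_top.ne
    simpa only [Pi.neg_apply, hneg] using this)
  refine ⟨_, ⌈C1 + C2⌉₊, hr1.sub hr2, fun k => ?_⟩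
  rw [integral_eq_lintegral_pos_part_sub_lintegral_neg_part hint]
  simp only [hneg]
  calc _ ≤ C1 / ((k:ℝ)+1) + C2 / ((k:ℝ)+1) := by
        refine le_trans ?_ (add_le_add (h1 k) (h2 k))
        rw [sub_sub_sub_comm]
        exact abs_sub _ _
    _ = (C1 + C2) / ((k:ℝ)+1) := (add_div _ _ _).symm
    _ ≤ _ := by
        gcongr
        exact Nat.le_ceil _


end PartP11

theorem chaitinOmega_not_period (M : List Bool →. List Bool)
    (hM : Partrec M) (hpf : PrefixFreeDom M) (huniv : UniversalPF M) :
    ¬ IsPeriod (chaitinOmega M) := by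
  intro hx
  obtain ⟨r, C, hr, h⟩ := period_approx hx
  exact omega_not_approx M hM hpf huniv r hr C h
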